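/- arXiv:2204.02732 — 2 statements merged into one kernel-verified Lean document; each statement's English description precedes it below -/
import Mathlib

section
/- Let ℓ ≥ 3 be an integer. For every v ≥ (3ℓ⁴ − 14ℓ³ + 27ℓ² − 24ℓ + 12)/4, every Steiner triple system of order v admits an ℓ-good sequencing. -/
/-- A Steiner triple system on point set `points` with block set `blocks`:
every block is a 3-element subset of `points`, and every pair of distinct
points lies in exactly one block. -/
def IsSTS {α : Type*} [DecidableEq α] (points : Finset α) (blocks : Finset (Finset α)) : Prop :=
  (∀ b ∈ blocks, b ⊆ points ∧ b.card = 3) ∧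
  (∀ x ∈ points, ∀ y ∈ points, x ≠ y → ∃! b, b ∈ blocks ∧ x ∈ b ∧ y ∈ b)

/-- An `ℓ`-good sequencing: a permutation (listing) of the points such that no
`ℓ` consecutive entries contain a block. -/
def IsGoodSeq {α : Type*} [DecidableEq α] (points : Finset α) (blocks : Finset (Finset α))
    (ℓ : ℕ) (L : List α) : Prop :=
  L.Nodup ∧ L.toFinset = points ∧
  ∀ i : ℕ, ∀ b ∈ blocks, ¬ b ⊆ ((L.drop i).take ℓ).toFinset

/-- A cyclic `ℓ`-good sequencing: a permutation (listing) of the points such that no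
`ℓ` cyclically consecutive entries contain a block. -/
def IsCyclicGoodSeq {α : Type*} [DecidableEq α] (points : Finset α) (blocks : Finset (Finset α))
    (ℓ : ℕ) (L : List α) : Prop :=
  L.Nodup ∧ L.toFinset = points ∧
  ∀ i : ℕ, ∀ b ∈ blocks, ¬ b ⊆ (((L ++ L).drop i).take ℓ).toFinset

/-- An independent set: a set of points containing no block. -/
def IsIndep {α : Type*} [DecidableEq α] (blocks : Finset (Finset α)) (I : Finset α) : Prop :=
  ∀ b ∈ blocks, ¬ b ⊆ I

/-- A (proper) colouring with colour set `Fin k`: no block is monochromatic,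
i.e. every colour class is an independent set. -/
def IsColouring {α : Type*} [DecidableEq α] (blocks : Finset (Finset α)) {k : ℕ}
    (χ : α → Fin k) : Prop :=
  ∀ b ∈ blocks, ∃ x ∈ b, ∃ y ∈ b, χ x ≠ χ y

/-- A colouring with three explicitly given colour classes `A`, `B`, `C`:
they partition the point set and each is independent. -/
def IsColouring3 {α : Type*} [DecidableEq α] (points : Finset α) (blocks : Finset (Finset α))
    (A B C : Finset α) : Prop :=
  A ∪ B ∪ C = points ∧ Disjoint A B ∧ Disjoint A C ∧ Disjoint B C ∧
  IsIndep blocks A ∧ IsIndep blocks B ∧ IsIndep blocks C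

section BlockAvoiding

variable {α : Type*} [DecidableEq α]

/-- No `m + 1` consecutive entries of the list contain a block. -/
def AvoidsBlocks (blocks : Finset (Finset α)) (m : ℕ) : List α → Prop
  | [] => True
  | x :: L => (∀ b ∈ blocks, ¬ b ⊆ (x :: L.take m).toFinset) ∧ AvoidsBlocks blocks m L

/-- The pairs of entries of a list that lie in a common segment of `m` consecutive entries. -/
def nearPairs (m : ℕ) : List α → Finset (Finset α)
  | [] => ∅
  | x :: L => (L.take (m - 1)).toFinset.image (fun y => {x, y}) ∪ nearPairs m L

/-- The point `z` completes one of the pairs in `P` to a block. -/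
def Completes (blocks P : Finset (Finset α)) (z : α) : Prop :=
  ∃ p ∈ P, z ∉ p ∧ insert z p ∈ blocks

/-- The pairs that matter for inserting a point after the first, second, …, `n`-th segment of
length `m` of a list. -/
def slotPairs (m : ℕ) : ℕ → List α → Finset (Finset α)
  | 0, _ => ∅
  | n + 1, S => nearPairs m (S.take (2 * m)) ∪ slotPairs m n (S.drop m)

variable {points : Finset α} {blocks : Finset (Finset α)} {m : ℕ}

lemma Completes.mono {P Q : Finset (Finset α)} {z : α} (h : Completes blocks P z) (hPQ : P ⊆ Q) :
    Completes blocks Q z := by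
  obtain ⟨p, hp, h⟩ := h
  exact ⟨p, hPQ hp, h⟩

lemma card_filter_completes_le (hS : IsSTS points blocks) (U : Finset α)
    (P : Finset (Finset α)) [DecidablePred (Completes blocks P)] :
    (U.filter (Completes blocks P)).card ≤ P.card := by
  refine Finset.card_le_card_of_forall_subsingleton
    (fun z p => z ∉ p ∧ insert z p ∈ blocks) ?_ ?_
  · intro z hz
    obtain ⟨p, hp, h⟩ := (Finset.mem_filter.1 hz).2
    exact ⟨p, hp, h⟩
  · rintro p - z ⟨-, hz, hzb⟩ w ⟨-, hw, hwb⟩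
    obtain ⟨hsub, hcard⟩ := hS.1 _ hzb
    rw [Finset.card_insert_of_notMem hz] at hcard
    obtain ⟨x, y, hxy, rfl⟩ := Finset.card_eq_two.1 (by omega : p.card = 2)
    have heq : insert z {x, y} = insert w {x, y} :=
      (hS.2 x (hsub (by simp)) y (hsub (by simp)) hxy).unique
        ⟨hzb, by simp, by simp⟩ ⟨hwb, by simp, by simp⟩
    have : z ∈ insert w ({x, y} : Finset α) := heq ▸ Finset.mem_insert_self _ _
    exact (Finset.mem_insert.1 this).resolve_right hz

lemma exists_not_completes (hS : IsSTS points blocks) {U : Finset α} {P : Finset (Finset α)}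
    (h : P.card < U.card) : ∃ x ∈ U, ¬ Completes blocks P x := by
  classical
  by_contra! hc
  have := card_filter_completes_le hS U P
  rw [Finset.filter_true_of_mem hc] at this
  omega

lemma card_nearPairs_cons_le (x : α) (L : List α) :
    (nearPairs m (x :: L)).card ≤ min (m - 1) L.length + (nearPairs m L).card := by
  refine (Finset.card_union_le _ _).trans (Nat.add_le_add_right ?_ _)
  refine Finset.card_image_le.trans ((List.toFinset_card_le _).trans ?_)
  simp

lemma card_nearPairs_append_le (A L : List α) :
    (nearPairs m (A ++ L)).card ≤ A.length * (m - 1) + (nearPairs m L).card := by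
  induction A with
  | nil => simp
  | cons a A ih =>
    have := card_nearPairs_cons_le (m := m) a (A ++ L)
    have := min_le_left (m - 1) (A ++ L).length
    rw [List.cons_append, List.length_cons, Nat.succ_mul]
    omega

lemma card_nearPairs_le_choose_length (L : List α) :
    (nearPairs m L).card ≤ L.length.choose 2 := by
  induction L with
  | nil => simp [nearPairs]
  | cons a L ih =>
    have := card_nearPairs_cons_le (m := m) a L
    have := min_le_right (m - 1) L.length
    have : (L.length + 1).choose 2 = L.length + L.length.choose 2 := by
      rw [Nat.choose_succ_succ' L.length 1, Nat.choose_one_right]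
    rw [List.length_cons]
    omega

lemma card_nearPairs_take_le (L : List α) : (nearPairs m (L.take m)).card ≤ m.choose 2 :=
  (card_nearPairs_le_choose_length _).trans (Nat.choose_le_choose 2 (by simp))

lemma card_nearPairs_take_two_mul_le (L : List α) :
    (nearPairs m (L.take (2 * m))).card ≤ 3 * m.choose 2 := by
  have h := card_nearPairs_append_le (m := m) (L.take m) ((L.drop m).take m)
  have h₂ := card_nearPairs_take_le (m := m) (L.drop m)
  rw [← List.take_add, ← two_mul] at h
  have h₁ : (L.take m).length * (m - 1) ≤ m * (m - 1) :=
    Nat.mul_le_mul_right _ (by simp)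
  have h₃ : m * (m - 1) = 2 * m.choose 2 := by
    rw [Nat.choose_two_right, Nat.mul_div_cancel' (Nat.even_mul_pred_self m).two_dvd]
  omega

lemma card_slotPairs_le (n : ℕ) (S : List α) :
    (slotPairs m n S).card ≤ n * (3 * m.choose 2) := by
  induction n generalizing S with
  | zero => simp [slotPairs]
  | succ n ih =>
    have h₁ := Finset.card_union_le (nearPairs m (S.take (2 * m))) (slotPairs m n (S.drop m))
    have h₂ := card_nearPairs_take_two_mul_le (m := m) S
    have h₃ := ih (S.drop m)
    rw [Nat.succ_mul, slotPairs]
    omega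

lemma mem_nearPairs_of_subset_take {p : Finset α} (hp : p.card = 2) (L : List α)
    (h : p ⊆ (L.take m).toFinset) : p ∈ nearPairs m L := by
  induction L generalizing m with
  | nil =>
    simp only [List.take_nil, List.toFinset_nil, Finset.subset_empty] at h
    simp [h] at hp
  | cons a L ih =>
    obtain ⟨x, y, hxy, rfl⟩ := Finset.card_eq_two.1 hp
    have key : ∀ k (L : List α) (z : α), z ∈ L.take k → z ∈ L.take (k + 1) := fun k L z hz =>
      (List.take_prefix_take_left (by omega)).subset hz
    cases m with
    | zero => simpa using h (Finset.mem_insert_self _ _)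
    | succ k =>
      have hx : x = a ∨ x ∈ L.take k := by simpa using h (by simp : x ∈ ({x, y} : Finset α))
      have hy : y = a ∨ y ∈ L.take k := by simpa using h (by simp : y ∈ ({x, y} : Finset α))
      simp only [nearPairs, Finset.mem_union, Finset.mem_image, List.mem_toFinset,
        Nat.add_sub_cancel]
      rcases hx with rfl | hx <;> rcases hy with rfl | hy
      · exact absurd rfl hxy
      · exact Or.inl ⟨y, hy, rfl⟩
      · exact Or.inl ⟨x, hx, Finset.pair_comm _ _⟩
      · refine Or.inr (ih ?_)
        intro z hz
        rcases Finset.mem_insert.1 hz with rfl | hz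
        · exact List.mem_toFinset.2 (key _ _ _ hx)
        · rw [Finset.mem_singleton.1 hz]
          exact List.mem_toFinset.2 (key _ _ _ hy)

lemma AvoidsBlocks.not_subset_take {L : List α} (h : AvoidsBlocks blocks m L)
    (hb : ∀ b ∈ blocks, b.card = 3) : ∀ b ∈ blocks, ¬ b ⊆ (L.take (m + 1)).toFinset := by
  cases L with
  | nil =>
    intro b hbb hsub
    have := hb b hbb
    simp only [List.take_nil, List.toFinset_nil, Finset.subset_empty] at hsub
    simp [hsub] at this
  | cons a L => exact h.1

lemma AvoidsBlocks.not_subset_drop_take {L : List α} (h : AvoidsBlocks blocks m L)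
    (hb : ∀ b ∈ blocks, b.card = 3) (i : ℕ) :
    ∀ b ∈ blocks, ¬ b ⊆ ((L.drop i).take (m + 1)).toFinset := by
  induction i generalizing L with
  | zero => exact h.not_subset_take hb
  | succ i ih =>
    cases L with
    | nil => simpa using ih h
    | cons a L => exact ih h.2

/-- If a block lies in `insert r W` but not in `W`, then `r` completes a pair in `W`. -/
lemma erase_pair_of_subset_insert {b W : Finset α} {r : α} (hb : b.card = 3)
    (hsub : b ⊆ insert r W) (hW : ¬ b ⊆ W) :
    (b.erase r).card = 2 ∧ b.erase r ⊆ W ∧ r ∉ b.erase r ∧ insert r (b.erase r) = b := by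
  have hr : r ∈ b := by
    by_contra hr
    exact hW ((Finset.subset_insert_iff_of_notMem hr).1 hsub)
  refine ⟨by rw [Finset.card_erase_of_mem hr, hb], Finset.subset_insert_iff.1 hsub,
    Finset.notMem_erase _ _, Finset.insert_erase hr⟩

lemma AvoidsBlocks.cons {L : List α} (h : AvoidsBlocks blocks m L)
    (hb : ∀ b ∈ blocks, b.card = 3) {x : α}
    (hx : ¬ Completes blocks (nearPairs m (L.take m)) x) : AvoidsBlocks blocks m (x :: L) := by
  refine ⟨fun b hbb hsub => hx ?_, h⟩
  rw [List.toFinset_cons] at hsub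
  have hW : ¬ b ⊆ (L.take m).toFinset := fun hc => h.not_subset_take hb b hbb
    (hc.trans (fun z hz => List.mem_toFinset.2
      ((List.take_prefix_take_left (by omega)).subset (List.mem_toFinset.1 hz))))
  obtain ⟨h2, hs, hr, hi⟩ := erase_pair_of_subset_insert (hb b hbb) hsub hW
  exact ⟨_, mem_nearPairs_of_subset_take h2 _ (by rwa [List.take_take, min_self]), hr, hi.symm ▸ hbb⟩

lemma AvoidsBlocks.of_append {A L : List α} (h : AvoidsBlocks blocks m (A ++ L)) :
    AvoidsBlocks blocks m L := by
  induction A with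
  | nil => exact h
  | cons a A ih => exact ih h.2

lemma AvoidsBlocks.insert_of_not_completes {A Q : List α} {r : α}
    (h : AvoidsBlocks blocks m (A ++ Q)) (hb : ∀ b ∈ blocks, b.card = 3)
    (hr : ¬ Completes blocks (nearPairs m (A ++ Q.take m)) r) :
    AvoidsBlocks blocks m (A ++ r :: Q) := by
  induction A with
  | nil => exact h.cons hb hr
  | cons a A ih =>
    refine ⟨fun b hbb hsub => ?_,
      ih h.2 fun hc => hr (hc.mono Finset.subset_union_right)⟩
    rcases le_or_gt m A.length with hm | hm
    · refine h.1 b hbb ?_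
      simpa [List.take_append_of_le_length hm] using hsub
    · obtain ⟨k, rfl⟩ : ∃ k, m = A.length + (k + 1) := ⟨m - A.length - 1, by omega⟩
      have hW : ¬ b ⊆ (a :: (A ++ Q.take k)).toFinset := fun hc => h.1 b hbb (hc.trans fun z hz => by
        refine List.mem_toFinset.2 (List.cons_subset_cons _ ?_ (List.mem_toFinset.1 hz))
        rw [List.append_eq, List.take_length_add_append]
        exact List.append_subset.2 ⟨List.subset_append_left _ _,
          List.Subset.trans (List.take_prefix_take_left (by omega)).subset
            (List.subset_append_right _ (Q.take (k + 1)))⟩)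
      have hsub' : b ⊆ insert r (a :: (A ++ Q.take k)).toFinset := by
        refine hsub.trans fun z hz => ?_
        simp only [List.append_eq, List.take_length_add_append, List.take_succ_cons,
          List.mem_toFinset, List.mem_cons, List.mem_append, Finset.mem_insert] at hz ⊢
        tauto
      obtain ⟨h2, hs, hrn, hi⟩ := erase_pair_of_subset_insert (hb b hbb) hsub' hW
      refine hr ⟨_, mem_nearPairs_of_subset_take h2 _ (hs.trans ?_), hrn, hi.symm ▸ hbb⟩
      have : ((a :: A) ++ Q.take (A.length + (k + 1))).take (A.length + (k + 1))
          = a :: (A ++ Q.take k) := by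
        rw [← Nat.add_assoc, List.cons_append, List.take_succ_cons, List.take_length_add_append,
          List.take_take, min_eq_left (by omega)]
      rw [this]

lemma AvoidsBlocks.append_of_le_length {T s Q Q' : List α} (hs : m ≤ s.length)
    (h : AvoidsBlocks blocks m (T ++ (s ++ Q))) (h' : AvoidsBlocks blocks m (s ++ Q')) :
    AvoidsBlocks blocks m (T ++ (s ++ Q')) := by
  induction T with
  | nil => exact h'
  | cons a T ih =>
    refine ⟨?_, ih h.2⟩
    have h₁ := h.1
    simp only [List.append_eq] at h₁ ⊢
    rw [← List.append_assoc, List.take_append_of_le_length (by simp; omega)] at h₁ ⊢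
    exact h₁

/-- Points completing no pair of `slotPairs m n S` can be inserted at the `n` slots of `S`. -/
lemma exists_perm_avoidsBlocks_of_slots (hb : ∀ b ∈ blocks, b.card = 3) (n : ℕ)
    (T S R : List α) (hS : S.length = n * m) (hR : R.length ≤ n)
    (h : AvoidsBlocks blocks m (T ++ S))
    (hr : ∀ r ∈ R, ¬ Completes blocks (slotPairs m n S) r) :
    ∃ L, AvoidsBlocks blocks m L ∧ L.Perm (T ++ S ++ R) := by
  induction n generalizing T S R with
  | zero =>
    obtain rfl : R = [] := List.eq_nil_of_length_eq_zero (by omega)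
    exact ⟨T ++ S, h, by simp⟩
  | succ n ih =>
    cases R with
    | nil => exact ⟨T ++ S, h, by simp⟩
    | cons r R =>
      rw [Nat.succ_mul] at hS
      have hlen : (S.take m).length = m := by simp; omega
      have hsplit : S.take m ++ S.drop m = S := List.take_append_drop _ _
      have h' : AvoidsBlocks blocks m (S.take m ++ r :: S.drop m) := by
        refine AvoidsBlocks.insert_of_not_completes (hsplit.symm ▸ h.of_append) hb fun hc => ?_
        refine hr r (by simp) (hc.mono ?_)
        rw [← List.take_add, ← two_mul]
        exact Finset.subset_union_left
      rw [← hsplit] at h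
      have h'' := AvoidsBlocks.append_of_le_length hlen.ge h h'
      obtain ⟨L, hL, hperm⟩ := ih (T ++ (S.take m ++ [r])) (S.drop m) R (by simp; omega)
        (by simpa using hR) (by simpa using h'')
        fun x hx hc => hr x (by simp [hx]) (hc.mono Finset.subset_union_right)
      refine ⟨L, hL, hperm.trans ?_⟩
      simp only [List.append_assoc, List.singleton_append]
      refine List.Perm.append_left T ?_
      conv_rhs => rw [← hsplit, List.append_assoc]
      exact List.Perm.append_left _ List.perm_middle.symm

/-- Greedily prepending `n` points of `U`. -/
lemma exists_append_of_card_le (hS : IsSTS points blocks) (n : ℕ) {L : List α}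
    (h : AvoidsBlocks blocks m L) {U : Finset α} (hU : n + m.choose 2 ≤ U.card) :
    ∃ A : List α, A.length = n ∧ A.Nodup ∧ A.toFinset ⊆ U ∧ AvoidsBlocks blocks m (A ++ L) := by
  induction n with
  | zero => exact ⟨[], by simp, by simp, by simp, h⟩
  | succ n ih =>
    obtain ⟨A, hlen, hnd, hAU, hA⟩ := ih (by omega)
    have hcard : (nearPairs m ((A ++ L).take m)).card < (U \ A.toFinset).card := by
      have h₁ := card_nearPairs_take_le (m := m) (A ++ L)
      have h₂ := Finset.le_card_sdiff A.toFinset U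
      have h₃ := A.toFinset_card_le
      omega
    obtain ⟨x, hx, hxc⟩ := exists_not_completes hS hcard
    obtain ⟨hxU, hxA⟩ := Finset.mem_sdiff.1 hx
    refine ⟨x :: A, by simp [hlen], List.nodup_cons.2 ⟨by simpa using hxA, hnd⟩, ?_,
      hA.cons (fun b hb => (hS.1 b hb).2) hxc⟩
    rw [List.toFinset_cons]
    exact Finset.insert_subset hxU hAU

/-- Greedily prepending all but at most `m.choose 2` points of `U`. -/
lemma exists_append_card_sdiff_le (hS : IsSTS points blocks) {L : List α}
    (h : AvoidsBlocks blocks m L) (U : Finset α) :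
    ∃ A : List α, A.Nodup ∧ A.toFinset ⊆ U ∧ (U \ A.toFinset).card ≤ m.choose 2 ∧
      AvoidsBlocks blocks m (A ++ L) := by
  rcases le_total U.card (m.choose 2) with hU | hU
  · exact ⟨[], by simp, by simp, by simpa using hU, h⟩
  · obtain ⟨A, hlen, hnd, hAU, hA⟩ :=
      exists_append_of_card_le hS (U.card - m.choose 2) h (U := U) (by omega)
    refine ⟨A, hnd, hAU, ?_, hA⟩
    rw [Finset.card_sdiff_of_subset hAU, List.toFinset_card_of_nodup hnd]
    omega

/-- Prepending points of `U` none of whose near pairs is completed by `b`. -/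
lemma exists_append_not_completes (hS : IsSTS points blocks) {L : List α}
    (h : AvoidsBlocks blocks m L) {U : Finset α} (b : α) (n : ℕ)
    (hU : m.choose 2 + 2 * n ≤ U.card + 1) :
    ∃ A : List α, A.length = n ∧ A.Nodup ∧ A.toFinset ⊆ U ∧ AvoidsBlocks blocks m (A ++ L) ∧
      ¬ Completes blocks (nearPairs m A) b := by
  induction n with
  | zero => exact ⟨[], by simp, by simp, by simp, h, by simp [Completes, nearPairs]⟩
  | succ n ih =>
    obtain ⟨A, hlen, hnd, hAU, hA, hbA⟩ := ih (by omega)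
    have hcard : (nearPairs m ((A ++ L).take m) ∪
        A.toFinset.image (fun y => ({b, y} : Finset α))).card < (U \ A.toFinset).card := by
      have h₀ := Finset.card_union_le (nearPairs m ((A ++ L).take m))
        (A.toFinset.image (fun y => ({b, y} : Finset α)))
      have h₁ := card_nearPairs_take_le (m := m) (A ++ L)
      have h₂ := Finset.le_card_sdiff A.toFinset U
      have h₃ := A.toFinset_card_le
      have h₄ := Finset.card_image_le (s := A.toFinset) (f := fun y => ({b, y} : Finset α))
      omega
    obtain ⟨x, hx, hxc⟩ := exists_not_completes hS hcard
    obtain ⟨hxU, hxA⟩ := Finset.mem_sdiff.1 hx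
    refine ⟨x :: A, by simp [hlen], List.nodup_cons.2 ⟨by simpa using hxA, hnd⟩, ?_,
      hA.cons (fun b hb => (hS.1 b hb).2) fun hc => hxc (hc.mono Finset.subset_union_left), ?_⟩
    · rw [List.toFinset_cons]
      exact Finset.insert_subset hxU hAU
    · rintro ⟨p, hp, hbp, hblock⟩
      rcases Finset.mem_union.1 hp with hp | hp
      · obtain ⟨y, hy, rfl⟩ := Finset.mem_image.1 hp
        have hyA : y ∈ A.toFinset := by
          rw [List.mem_toFinset] at hy ⊢
          exact List.mem_of_mem_take hy
        refine hxc ⟨{b, y}, Finset.mem_union_right _ (Finset.mem_image_of_mem _ hyA), ?_, ?_⟩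
        · simp only [Finset.mem_insert, Finset.mem_singleton, not_or] at hbp ⊢
          exact ⟨Ne.symm hbp.1, fun hxy => hxA (hxy ▸ hyA)⟩
        · rwa [Finset.insert_comm]
      · exact hbA ⟨p, hp, hbp, hblock⟩

/-- Prepending all points of `B`, with points of `U` as spacers. -/
lemma exists_append_superset (hS : IsSTS points blocks) (B : Finset α) {L : List α}
    (h : AvoidsBlocks blocks m L) {U : Finset α} (hBU : Disjoint B U)
    (hU : m.choose 2 + m + B.card * m ≤ U.card + 1) :
    ∃ A : List α, A.Nodup ∧ B ⊆ A.toFinset ∧ A.toFinset ⊆ B ∪ U ∧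
      AvoidsBlocks blocks m (A ++ L) := by
  induction B using Finset.induction_on generalizing L U with
  | empty => exact ⟨[], by simp, by simp, by simp, h⟩
  | insert b B hbB ih =>
    rw [Finset.card_insert_of_notMem hbB, Nat.succ_mul] at hU
    obtain ⟨hbU, hBU⟩ := Finset.disjoint_insert_left.1 hBU
    obtain ⟨A, hlen, hnd, hAU, hA, hbA⟩ :=
      exists_append_not_completes hS h (U := U) b m (by omega)
    have hbAL : AvoidsBlocks blocks m (b :: (A ++ L)) := by
      refine hA.cons (fun b hb => (hS.1 b hb).2) ?_
      rwa [List.take_append_of_le_length hlen.ge, List.take_of_length_le hlen.le]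
    obtain ⟨A', hnd', hBA', hA'U, hA'⟩ := ih hbAL (U := U \ A.toFinset)
      (hBU.mono_right Finset.sdiff_subset) (by
        have h₂ := Finset.le_card_sdiff A.toFinset U
        have h₃ := A.toFinset_card_le
        omega)
    have hmem : ∀ x ∈ A', x ∈ B ∨ x ∈ U ∧ x ∉ A := fun x hx => by
      simpa using hA'U (List.mem_toFinset.2 hx)
    have hAmem : ∀ x ∈ A, x ∈ U := fun x hx => hAU (List.mem_toFinset.2 hx)
    have hdisj : ∀ x ∈ B, x ∉ U := fun x hx => Finset.disjoint_left.1 hBU hx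
    refine ⟨A' ++ b :: A, ?_, ?_, ?_, by simpa using hA'⟩
    · rw [List.nodup_append, List.nodup_cons]
      refine ⟨hnd', ⟨fun hc => hbU (hAmem b hc), hnd⟩, ?_⟩
      grind
    · intro x hx
      have := @hBA' x
      simp only [Finset.mem_insert, List.mem_toFinset, List.mem_append, List.mem_cons] at *
      tauto
    · intro x hx
      have := hmem x
      have := hAmem x
      simp only [Finset.mem_insert, Finset.mem_union, List.mem_toFinset, List.mem_append,
        List.mem_cons] at *
      tauto

/-- A Steiner triple system with sufficiently many points has an ordering of its points in which
no `m + 1` consecutive ones contain a block. -/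
lemma exists_nodup_avoidsBlocks (hS : IsSTS points blocks)
    (hv : 3 * m.choose 2 ^ 2 + m ^ 3 + 1 ≤ points.card) :
    ∃ L : List α, L.Nodup ∧ L.toFinset = points ∧ AvoidsBlocks blocks m L := by
  classical
  set c := m.choose 2 with hc
  have h2c : m * m = 2 * c + m := by
    have : 2 * c = m * (m - 1) := by
      rw [hc, Nat.choose_two_right, Nat.mul_div_cancel' (Nat.even_mul_pred_self m).two_dvd]
    cases m with
    | zero => simp at this ⊢; omega
    | succ k => rw [this, Nat.add_sub_cancel]; ring
  have hm3 : m ^ 3 = 2 * (c * m) + 2 * c + m := by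
    calc m ^ 3 = (m * m) * m := by ring
      _ = (2 * c + m) * m := by rw [h2c]
      _ = 2 * (c * m) + m * m := by ring
      _ = _ := by rw [h2c, Nat.add_assoc]
  obtain ⟨S, hlen, hSnd, hSsub, hSgood⟩ := exists_append_of_card_le (m := m) hS (c * m)
    (L := []) trivial (U := points) (by omega)
  rw [List.append_nil] at hSgood
  set P := slotPairs m c S with hP
  set B := (points \ S.toFinset).filter (Completes blocks P) with hB
  set U := (points \ S.toFinset).filter (fun x => ¬ Completes blocks P x) with hU
  have hBcard : B.card ≤ 3 * c ^ 2 :=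
    (card_filter_completes_le hS _ P).trans ((card_slotPairs_le c S).trans_eq (by ring))
  have hUcard : points.card ≤ c * m + B.card + U.card := by
    have h₁ : B.card + U.card = (points \ S.toFinset).card := by
      convert Finset.card_filter_add_card_filter_not (s := points \ S.toFinset)
        (Completes blocks P)
    have h₂ := Finset.le_card_sdiff S.toFinset points
    have h₃ := S.toFinset_card_le
    omega
  obtain ⟨A₁, hnd₁, hsub₁, hcard₁, hgood₁⟩ := exists_append_card_sdiff_le hS hSgood B
  have hBU : Disjoint B U := Finset.disjoint_filter_filter_not _ _ _
  obtain ⟨A₂, hnd₂, hsup₂, hsub₂, hgood₂⟩ := exists_append_superset hS (B \ A₁.toFinset) hgood₁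
    (U := U) (hBU.mono_left Finset.sdiff_subset) (by
      have : (B \ A₁.toFinset).card * m ≤ c * m := Nat.mul_le_mul_right m hcard₁
      omega)
  obtain ⟨A₃, hnd₃, hsub₃, hcard₃, hgood₃⟩ :=
    exists_append_card_sdiff_le hS hgood₂ (U \ A₂.toFinset)
  obtain ⟨L, hL, hperm⟩ := exists_perm_avoidsBlocks_of_slots (fun b hb => (hS.1 b hb).2) c
    (A₃ ++ (A₂ ++ A₁)) S ((U \ A₂.toFinset) \ A₃.toFinset).toList hlen (by simpa using hcard₃)
    (by simpa using hgood₃) (fun r hr => by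
      simp only [hU, Finset.mem_toList, Finset.mem_sdiff, Finset.mem_filter] at hr
      exact hr.1.1.2)
  have mS : ∀ x ∈ S, x ∈ points := fun x hx => hSsub (List.mem_toFinset.2 hx)
  have mB : ∀ x, x ∈ B ↔ (x ∈ points ∧ x ∉ S) ∧ Completes blocks P x := by simp [hB]
  have mU : ∀ x, x ∈ U ↔ (x ∈ points ∧ x ∉ S) ∧ ¬ Completes blocks P x := by simp [hU]
  have m₁ : ∀ x ∈ A₁, x ∈ B := fun x hx => hsub₁ (List.mem_toFinset.2 hx)
  have m₂ : ∀ x ∈ A₂, x ∈ B ∧ x ∉ A₁ ∨ x ∈ U := fun x hx => by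
    simpa using hsub₂ (List.mem_toFinset.2 hx)
  have m₂' : ∀ x ∈ B, x ∉ A₁ → x ∈ A₂ := fun x hx hx' => by
    simpa using hsup₂ (Finset.mem_sdiff.2 ⟨hx, by simpa using hx'⟩)
  have m₃ : ∀ x ∈ A₃, x ∈ U ∧ x ∉ A₂ := fun x hx => by
    simpa using hsub₃ (List.mem_toFinset.2 hx)
  refine ⟨L, ?_, ?_, hL⟩
  · rw [hperm.nodup_iff]
    simp only [List.nodup_append, List.mem_append, Finset.mem_toList, Finset.mem_sdiff,
      List.mem_toFinset]
    refine ⟨⟨⟨hnd₃, ⟨hnd₂, hnd₁, ?_⟩, ?_⟩, hSnd, ?_⟩, Finset.nodup_toList _, ?_⟩ <;> grind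
  · rw [List.toFinset_eq_of_perm _ _ hperm]
    ext x
    simp only [List.mem_append, Finset.mem_toList, Finset.mem_sdiff, List.mem_toFinset]
    grind

end BlockAvoiding

theorem stmt2 (ℓ : ℕ) (hℓ : 3 ≤ ℓ) {α : Type*} [DecidableEq α]
    (points : Finset α) (blocks : Finset (Finset α)) (hS : IsSTS points blocks)
    (hv : 4 * (points.card : ℤ) ≥ 3 * ℓ ^ 4 - 14 * ℓ ^ 3 + 27 * ℓ ^ 2 - 24 * ℓ + 12) :
    ∃ L : List α, IsGoodSeq points blocks ℓ L := by
  obtain ⟨k, rfl⟩ : ∃ k, ℓ = k + 1 + 1 := ⟨ℓ - 2, by omega⟩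
  have hc : (2 * ((k + 1).choose 2 : ℤ)) = (k + 1) * k := by
    have : 2 * (k + 1).choose 2 = (k + 1) * k := by
      rw [Nat.choose_two_right, Nat.mul_div_cancel' (Nat.even_mul_pred_self _).two_dvd,
        Nat.add_sub_cancel]
    exact_mod_cast this
  obtain ⟨L, hnd, hpts, hL⟩ := exists_nodup_avoidsBlocks (m := k + 1) hS (by
    have hc2 : 4 * ((k + 1).choose 2 : ℤ) ^ 2 = ((k + 1) * k) ^ 2 := by rw [← hc]; ring
    zify
    push_cast at hv
    linarith)
  exact ⟨L, hnd, hpts, hL.not_subset_drop_take fun b hb => (hS.1 b hb).2⟩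
end

section
/- Let v ≥ 13. Then every Steiner triple system of order v admits a 4-good sequencing. -/
section Sequencing

variable {α : Type*} [DecidableEq α] {blocks : Finset (Finset α)}

/-- No four consecutive entries of the list contain a block. -/
def BlockFree (blocks : Finset (Finset α)) (L : List α) : Prop :=
  ∀ i : ℕ, ∀ b ∈ blocks, ¬ b ⊆ ((L.drop i).take 4).toFinset

/-- Triples any two of which share at most one point. -/
structure IsPartialSTS (blocks : Finset (Finset α)) : Prop where
  card_eq : ∀ b ∈ blocks, b.card = 3
  eq_of_pair : ∀ b ∈ blocks, ∀ c ∈ blocks, ∀ x y, x ≠ y →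
    x ∈ b → y ∈ b → x ∈ c → y ∈ c → b = c

theorem IsSTS.isPartialSTS {points : Finset α} (hS : IsSTS points blocks) :
    IsPartialSTS blocks where
  card_eq b hb := (hS.1 b hb).2
  eq_of_pair b hb _ hc x y hxy hxb hyb hxc hyc :=
    (hS.2 x ((hS.1 b hb).1 hxb) y ((hS.1 b hb).1 hyb) hxy).unique ⟨hb, hxb, hyb⟩ ⟨hc, hxc, hyc⟩

theorem blockFree_nil (hB : IsPartialSTS blocks) : BlockFree blocks ([] : List α) := by
  intro i b hb hsub
  have := hB.card_eq b hb
  have := Finset.card_le_card hsub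
  simp_all

theorem BlockFree.cons (hB : IsPartialSTS blocks) {L : List α} {y : α} (hL : BlockFree blocks L)
    (hy : ∀ p ∈ L.take 3, ∀ q ∈ L.take 3, ({p, q, y} : Finset α) ∉ blocks) :
    BlockFree blocks (y :: L) := by
  rintro (_ | i) b hb hsub
  · have hsub' : b ⊆ insert y (L.take 3).toFinset := by simpa using hsub
    by_cases hyb : y ∈ b
    · have hcard : (b.erase y).card = 2 := by
        rw [Finset.card_erase_of_mem hyb, hB.card_eq b hb]
      obtain ⟨p, q, -, hpq⟩ := Finset.card_eq_two.1 hcard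
      have hmem : ∀ z ∈ b.erase y, z ∈ L.take 3 := fun z hz => by
        have := hsub' (Finset.mem_of_mem_erase hz)
        rw [Finset.mem_insert] at this
        exact List.mem_toFinset.1 (this.resolve_left (Finset.ne_of_mem_erase hz))
      refine hy p (hmem p (by simp [hpq])) q (hmem q (by simp [hpq])) ?_
      have : ({p, q, y} : Finset α) = b := by
        rw [← Finset.insert_erase hyb, hpq]
        ext z
        simp only [Finset.mem_insert, Finset.mem_singleton]
        tauto
      rwa [this]
    · refine hL 0 b hb fun z hz => ?_
      have := hsub' hz
      rw [Finset.mem_insert] at this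
      have hz' := List.mem_toFinset.1 (this.resolve_left fun h => hyb (h ▸ hz))
      exact List.mem_toFinset.2 ((List.take_subset_take_left L (by norm_num : 3 ≤ 4)) hz')
  · exact hL i b hb (by simpa using hsub)

/-- A short enough block-free list can be extended by a further point. -/
theorem exists_blockFree_cons (hB : IsPartialSTS blocks) {points : Finset α} {L : List α}
    (hL : BlockFree blocks L) (hlen : L.length + 9 < points.card) :
    ∃ y ∈ points, y ∉ L ∧ BlockFree blocks (y :: L) := by
  classical
  let P := (L.take 3).toFinset ×ˢ (L.take 3).toFinset
  let third : α × α → α := fun pq =>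
    if h : pq.1 ≠ pq.2 ∧ ∃ y, y ∉ L ∧ ({pq.1, pq.2, y} : Finset α) ∈ blocks then h.2.choose
    else pq.1
  have h3 : (L.take 3).toFinset.card ≤ 3 :=
    (List.toFinset_card_le _).trans (List.length_take_le _ _)
  have hP : (P.image third).card ≤ 9 :=
    Finset.card_image_le.trans (by rw [Finset.card_product]; nlinarith)
  have hcard : (L.toFinset ∪ P.image third).card < points.card :=
    lt_of_le_of_lt (Finset.card_union_le _ _)
      (by have := List.toFinset_card_le L; omega)
  obtain ⟨y, hy, hyn⟩ := Finset.exists_mem_notMem_of_card_lt_card hcard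
  simp only [Finset.mem_union, List.mem_toFinset, not_or] at hyn
  refine ⟨y, hy, hyn.1, hL.cons hB fun p hp q hq hblock => hyn.2 ?_⟩
  refine Finset.mem_image.2 ⟨(p, q), by simp [P, hp, hq], ?_⟩
  have hpq : p ≠ q := by
    rintro rfl
    have := hB.card_eq _ hblock
    have := Finset.card_le_two (a := p) (b := y)
    simp_all
  have hex : ∃ y, y ∉ L ∧ ({p, q, y} : Finset α) ∈ blocks := ⟨y, hyn.1, hblock⟩
  have hthird : third (p, q) = hex.choose := dif_pos (c := p ≠ q ∧ _) ⟨hpq, hex⟩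
  obtain ⟨hnot, hblock'⟩ := hex.choose_spec
  rw [hthird]
  have heq := hB.eq_of_pair _ hblock' _ hblock p q hpq (by simp) (by simp) (by simp) (by simp)
  have hmem : hex.choose ∈ ({p, q, y} : Finset α) := heq ▸ (by simp)
  simp only [Finset.mem_insert, Finset.mem_singleton] at hmem
  rcases hmem with h | h | h
  · rw [h] at hnot
    exact absurd (List.mem_of_mem_take hp) hnot
  · rw [h] at hnot
    exact absurd (List.mem_of_mem_take hq) hnot
  · exact h

theorem exists_blockFree_of_length (hB : IsPartialSTS blocks) (points : Finset α) (n : ℕ)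
    (hn : n + 9 ≤ points.card) :
    ∃ L : List α, L.Nodup ∧ L.toFinset ⊆ points ∧ L.length = n ∧ BlockFree blocks L := by
  induction n with
  | zero => exact ⟨[], by simp, by simp, rfl, blockFree_nil hB⟩
  | succ n ih =>
    obtain ⟨L, hnd, hsub, hlen, hL⟩ := ih (by omega)
    obtain ⟨y, hy, hyL, hgood⟩ := exists_blockFree_cons hB (points := points) hL (by omega)
    refine ⟨y :: L, List.nodup_cons.2 ⟨hyL, hnd⟩, ?_, by simp [hlen], hgood⟩
    rw [List.toFinset_cons]
    exact Finset.insert_subset hy hsub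

/-! ### Labelled configurations

The last three points placed carry the labels `2`, `1`, `0` (latest first) and ten further points
the labels `3, …, 12`; `π` sends a label to its point. -/

/-- The ten points labelled `3, …, 12` can be placed in some order after the list
`π 2, π 1, π 0, R` (latest first). -/
def Completable (blocks : Finset (Finset α)) (R : List α) (π : ℕ → α) : Prop :=
  ∃ l : List α, l.Perm ((List.range' 3 10).map π) ∧
    BlockFree blocks (l ++ π 2 :: π 1 :: π 0 :: R)

/-- Every labelling under which the label sets in `Y` are blocks is completable. -/
def Sufficient (blocks : Finset (Finset α)) (R : List α) (Y : List (List ℕ)) : Prop :=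
  ∀ π : ℕ → α, Set.InjOn π (Set.Iio 13) → BlockFree blocks (π 2 :: π 1 :: π 0 :: R) →
    (∀ t ∈ Y, (t.map π).toFinset ∈ blocks) → Completable blocks R π

/-- The triples of entries within four consecutive positions that involve an entry
having three others after it. -/
def closeTriples : List ℕ → List (List ℕ)
  | y :: c :: b :: a :: l => [a, b, y] :: [a, c, y] :: [b, c, y] :: closeTriples (c :: b :: a :: l)
  | _ => []

/-- The bit set of a list of labels. -/
def labelMask (l : List ℕ) : ℕ := l.foldr (fun d m => 2 ^ d ||| m) 0

/-- The lowest `k` base-100 digits of `n`, least significant first. -/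
def labelDigits : ℕ → ℕ → List ℕ
  | 0, _ => []
  | k + 1, n => n % 100 :: labelDigits k (n / 100)

/-- The map fixing the labels `0, 1, 2` and sending `3, 4, …` to the base-100 digits of `s`,
least significant first. -/
def relabel (s i : ℕ) : ℕ := if i < 3 then i else s / 100 ^ (i - 3) % 100

/-- `relabel s` permutes `3, …, 12`. -/
def isRelabelling (s : ℕ) : Bool := labelMask (labelDigits 10 s) == 2 ^ 13 - 2 ^ 3

/-- Some member of `Y` has exactly two labels in common with `t`. -/
def clashes (Y : List (List ℕ)) (t : List ℕ) : Bool :=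
  Y.any fun b => (t.filter fun x => (labelMask b).testBit x).length == 2

/-- The family `Z` is relabelled by `s` into the family with bit sets `M`. -/
def embeds (M : List ℕ) (s : ℕ) (Z : List (List ℕ)) : Bool :=
  isRelabelling s && Z.all fun b => M.any fun m => Nat.beq m (labelMask (b.map (relabel s)))

/-- Each triple in the list clashes with `Y` or, added to `Y`, yields a relabelled copy of an
earlier family, as witnessed by the list of pairs (index of the family, relabelling). -/
def excludes (earlier : List (List (List ℕ))) (Y : List (List ℕ)) (M : List ℕ) :
    List (List ℕ) → List (ℕ × ℕ) → Bool
  | [], _ => true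
  | t :: ts, refs =>
    if clashes Y t then excludes earlier Y M ts refs
    else match refs with
      | [] => false
      | (k, s) :: refs =>
        (match earlier[k]? with
          | none => false
          | some Z => embeds (labelMask t :: M) s Z) && excludes earlier Y M ts refs

/-- Processes a certificate: each entry consists of a family of blocks, an order of the labels
`3, …, 12`, and the witnesses excluding all blocks among the close triples of that order. -/
def certify : List (List (List ℕ)) → List (List ℕ × ℕ × List (ℕ × ℕ)) → Bool
  | earlier, [] => earlier.head? == some []
  | earlier, (Y, q, refs) :: rest =>
    let Y := Y.map (labelDigits 3)
    let M := Y.map labelMask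
    (M.all fun m => Nat.ble m (2 ^ 13 - 1)) &&
    isRelabelling q &&
    excludes earlier Y M (closeTriples (labelDigits 10 q ++ [2, 1, 0])) refs &&
    certify (Y :: earlier) rest

set_option maxRecDepth 10000 in
/-- Families of blocks, orders and witnesses in the format read by `certify`. -/
def certificate : List (List ℕ × ℕ × List (ℕ × ℕ)) := [
  ([31012, 40809, 60708, 30509, 70911, 50611, 10211, 204, 108], 9040506080312071110, []),
  ([31012, 40809, 60708, 30509, 70911, 50611, 10211, 204], 8041105091210070603, [(0,
    12111009080706050403)]),
  ([31012, 40809, 60708, 30509, 70911, 50611, 10211, 104, 208], 6080503071112100904, []),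
  ([31012, 40809, 60708, 30509, 70911, 50611, 10211, 104], 8041105091012070603, [(0,
    12111009080706050403)]),
  ([31012, 40809, 60708, 30509, 70911, 50611, 10211], 4081105091210070603, [(0,
    12111009080706050403), (2, 12111009080706050403)]),
  ([31012, 40809, 60708, 30509, 70911, 10209, 205, 111], 7060503080410120911, []),
  ([31012, 40809, 60708, 30509, 70911, 10209, 205], 4080503060712101109, [(0,
    12041009070806051103)]),
  ([31012, 40809, 60708, 70911, 50611, 10209, 105, 212], 6050908071203110410, [(2,
    12090311060708040510), (2, 10090311060708040512), (2, 12091011060708040503)]),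
  ([31012, 40809, 60708, 30509, 70911, 50611, 10209, 105], 12100907030605080411, [(0,
    12111009080706050403)]),
  ([31012, 40809, 60708, 30509, 70911, 50611, 10209], 5060908030712111004, [(4,
    10090311060708040512), (4, 12090311060708040510), (0, 12111009080706050403), (2,
    12111009080706050403)]),
  ([31012, 40809, 60708, 30509, 70911, 209, 111, 10205], 8060503071110120904, []),
  ([31012, 40809, 60708, 30509, 70911, 50611, 209, 50712, 111], 5090704120803061011, [(0,
    12111009080706050403)]),
  ([31012, 40809, 60708, 30509, 70911, 50611, 209, 50712], 11090603070508041210, [(0,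
    12111009080706050403), (7, 12111009080706050403)]),
  ([31012, 40809, 60708, 30509, 70911, 50611, 209, 111, 60910], 5090612110710030804, [(2,
    12111009080706050403)]),
  ([31012, 40809, 60708, 30509, 70911, 50611, 209, 111], 5110912060703100804, [(0,
    10111209080706050403), (3, 12111009080706050403)]),
  ([31012, 40809, 60708, 30509, 70911, 50611, 209], 11090512070610030804, [(2,
    12111009080706050403), (0, 12111009080706050403), (10, 12111009080706050403)]),
  ([31012, 40809, 60708, 30509, 70911, 109, 211, 10205], 4080503060710121109, []),
  ([31012, 40809, 60708, 30509, 70911, 50611, 109, 50712, 211], 5110704120903080610, [(1,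
    10090311060708040512), (0, 12111009080706050403)]),
  ([31012, 40809, 60708, 30509, 70911, 50611, 109, 50712], 11090510070612030804, [(0,
    12111009080706050403), (13, 12111009080706050403)]),
  ([31012, 40809, 60708, 30509, 70911, 50611, 109, 211, 60910], 5090607121103041008, [(3,
    12090311060708040510), (3, 10090311060708040512), (3, 12091011060708040503), (2,
    12111009080706050403)]),
  ([31012, 40809, 60708, 30509, 70911, 50611, 109, 211], 5110307060910120408, [(0,
    10111209080706050403), (0, 12111009080706050403), (3, 12111009080706050403)]),
  ([31012, 40809, 60708, 30509, 70911, 50611, 109], 11090512070610030804, [(2,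
    12111009080706050403), (0, 12111009080706050403), (16, 12111009080706050403)]),
  ([31012, 40809, 60708, 30509, 70911, 50611], 9110504080312070610, [(17, 12111009080706050403),
    (0, 12111009080706050403), (6, 12111009080706050403), (12, 12111009080706050403)]),
  ([31012, 40809, 60708, 30509, 70911, 20511, 10207, 105, 60912], 11091210040803050607, []),
  ([31012, 40809, 60708, 30509, 70911, 20511, 10207, 30406, 105], 11090406121008070305, [(0,
    12111009080706050403)]),
  ([31012, 40809, 60708, 30509, 70911, 20511, 10207, 30406], 5030711060408121009, [(0,
    12111009080706050403)]),
  ([31012, 40809, 60708, 30509, 70911, 20511, 10207, 111], 5090406030812071011, [(0,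
    12111009080706050403), (3, 12041009070806051103)]),
  ([31012, 40809, 60708, 30509, 70911, 20511, 10207], 11090405060307100812, [(1,
    12111009080706050403), (4, 12041009070806051103), (0, 12111009080706050403)]),
  ([31012, 40809, 60708, 30509, 20511, 111, 207, 10204], 9110405080307100612, []),
  ([31012, 40809, 60708, 30509, 70911, 20511, 111, 207], 4110805060307120910, [(0,
    12111009080706050403)]),
  ([31012, 40809, 60708, 30509, 70911, 20511, 111], 7110605080304100912, [(0,
    12111009080706050403), (2, 12111009080706050403)]),
  ([31012, 40809, 60708, 30509, 70911, 20511], 11070605030804121009, [(3, 12111009080706050403),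
    (0, 12111009080706050403)]),
  ([31012, 40809, 60708, 30509, 70911, 10209, 105, 211], 4050906080312071110, [(9,
    12041009070806051103), (0, 12041009070806051103)]),
  ([31012, 40809, 60708, 30509, 70911, 10209, 105], 4050906080310071112, [(10,
    12041009070806051103), (1, 12041009070806051103), (0, 12041009070806051103)]),
  ([31012, 40809, 60708, 30509, 70911, 10209, 30406, 60910], 5030411090608121007, [(11,
    12081004110907060503), (2, 12041009070806051103), (0, 12111009080706050403), (27,
    12111009080706050403)]),
  ([31012, 40809, 60708, 30509, 70911, 10209, 30406], 5030411090608101207, [(0,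
    12111009080706050403), (12, 12081004110907060503), (3, 12041009070806051103), (1,
    12111009080706050403), (28, 12111009080706050403)]),
  ([31012, 40809, 60708, 30509, 70911, 10209, 10405], 5110906030712081004, [(0,
    12041009070806051103), (13, 12111009080706050403), (4, 12111009080706050403), (29,
    12111009080706050403)]),
  ([31012, 40809, 60708, 30509, 70911, 10209], 5110906030408121007, [(1, 12111009080706050403),
    (1, 12041009070806051103), (14, 12111009080706050403), (0, 12041009070806051103), (5,
    12111009080706050403), (3, 12111009080706050403), (30, 12111009080706050403)]),
  ([31012, 40809, 60708, 30509, 70911, 209, 111, 20611], 5091106030712081004, [(27,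
    12111009080706050403)]),
  ([31012, 40809, 60708, 30509, 70911, 10204, 209, 111], 6110705030804101209, [(16,
    12111009080706050403), (0, 12111009080706050403)]),
  ([31012, 40809, 60708, 30509, 70911, 10204, 209], 11090506070312080410, [(17,
    12111009080706050403), (8, 12111009080706050403), (0, 12111009080706050403)]),
  ([31012, 40809, 60708, 30509, 70911, 109, 211, 10611], 5091106030712081004, [(24,
    12111009080706050403)]),
  ([31012, 40809, 60708, 30509, 70911, 10204, 109, 211], 6110705030804121009, [(19,
    12111009080706050403), (0, 12111009080706050403)]),
  ([31012, 40809, 60708, 30509, 70911, 10204, 109], 11090506070310080412, [(20,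
    12111009080706050403), (11, 12111009080706050403), (0, 12111009080706050403)]),
  ([31012, 40809, 60708, 30509, 70911, 10204], 9110506070310080412, [(21, 12111009080706050403),
    (12, 12111009080706050403), (0, 12111009080706050403), (3, 12111009080706050403)]),
  ([31012, 40809, 60708, 30509, 70911, 209, 111], 4090506080310071112, [(22,
    12041009070806051103), (13, 12041009070806051103), (0, 12111009080706050403)]),
  ([31012, 40809, 60708, 30509, 70911, 209], 11090506070312080410, [(23, 12111009080706050403),
    (14, 12111009080706050403), (0, 12111009080706050403), (1, 12041009070806051103)]),
  ([31012, 40809, 60708, 30509, 70911, 109, 204], 11090506070312080410, [(24,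
    12111009080706050403), (15, 12111009080706050403), (2, 12041009070806051103)]),
  ([31012, 40809, 60708, 30509, 70911, 109], 4090506080312071110, [(25, 12041009070806051103),
    (16, 12041009070806051103), (0, 12111009080706050403), (3, 12111009080706050403)]),
  ([31012, 40809, 60708, 30509, 70911], 9110506070312080410, [(26, 12111009080706050403), (17,
    12111009080706050403), (4, 12041009070806051103), (0, 12111009080706050403), (2,
    12111009080706050403), (11, 12111009080706050403)]),
  ([31012, 40809, 60708, 20506, 20911, 41011, 105], 11050406071012080903, [(0,
    12090304070806110510)]),
  ([31012, 40809, 60708, 30509, 20506, 20911, 41011], 5091204030810061107, [(1,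
    7110604121003090508), (0, 12111009080706050403)]),
  ([31012, 40809, 60708, 30509, 20506, 81112, 109], 6090405120308071011, [(2,
    5060308110710041209), (2, 7100612050309110408)]),
  ([31012, 40809, 60708, 30509, 20506, 20911, 81112], 9050412030807101106, [(3,
    5070308110610041209), (3, 5060308110710041209), (3, 7100612050309110408), (0,
    12111009080706050403)]),
  ([31012, 40809, 60708, 30509, 20506, 20911, 109], 5090706031008041211, [(0,
    12111009080706050403), (2, 10111209080706050403)]),
  ([31012, 40809, 60708, 30509, 20506, 20911], 9050706031008041211, [(1, 12111009080706050403),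
    (3, 10111209080706050403), (0, 12111009080706050403)]),
  ([31012, 40809, 60708, 30509, 20506, 10511, 40510, 10207], 5100706041108030912, [(6,
    7050604031012091108), (6, 7090603100504111208), (6, 12090304070806051110), (6,
    12090304060807051110)]),
  ([31012, 40809, 60708, 30509, 20506, 10511, 40510], 5070803100611040912, [(7,
    7050604121003091108), (7, 7050609120310041108), (7, 12041009060807051103), (7,
    12090304060807051110), (7, 8090703100504111206), (7, 8040710030509111206), (0,
    12111009080706050403)]),
  ([31012, 40809, 60708, 30509, 20506, 106, 211, 10208], 12100605030807091104, [(29,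
    12061009041107050803), (8, 12041009070806051103)]),
  ([31012, 40809, 60708, 30509, 20506, 10511, 106, 211], 8110907060312050410, [(1,
    12110304080706050910), (1, 10110304080706050912), (9, 12041009060807051103), (9,
    12041009070806051103), (0, 12111009080706050403)]),
  ([31012, 40809, 60708, 30509, 20506, 10511, 106], 11060907030810041205, [(2,
    12110304080706050910), (2, 10110304080706050912), (10, 12041009070806051103), (4,
    12111009080706050403), (10, 12041009060807051103), (0, 12111009080706050403)]),
  ([31012, 40809, 60708, 30509, 20506, 10511], 6110905100403081207, [(3, 12110304080706050910),
    (11, 7050609100312041108), (5, 12111009080706050403), (11, 12041009060807051103), (0,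
    12111009080706050403)]),
  ([31012, 40809, 60708, 30509, 20506, 10211, 61112, 105], 6071003080412110905, [(6,
    9050406120310071108)]),
  ([31012, 40809, 60708, 30509, 20506, 10211, 61112], 5091112040803100607, [(0,
    12111009080706050403)]),
  ([31012, 40809, 60708, 30509, 20506, 10211, 105, 40612], 6041109121008070305, [(14,
    7050609100312041108), (14, 8100712090305041106), (14, 12041009060807051103)]),
  ([31012, 40809, 60708, 30509, 20506, 10211, 70912, 105], 6071204080310091105, [(15,
    11121009080706030405), (15, 7050609100312041108), (0, 12111009080706050403)]),
  ([31012, 40809, 60708, 30509, 20506, 10211, 70912], 5091106120710080304, [(2,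
    12111009080706050403), (16, 12041009060807051103), (0, 12111009080706050403)]),
  ([31012, 60708, 30509, 20506, 10211, 71011, 106], 5091107031208061004, [(17,
    9110510080706120403), (17, 9110510060708120403)]),
  ([31012, 40809, 60708, 30509, 20506, 10211, 71011], 6071105091004030812, [(18,
    8120610050309110407), (0, 12111009080706050403)]),
  ([31012, 40809, 60708, 30509, 20506, 10211, 106], 5091106071210080403, [(5,
    12111009080706050403), (1, 10111209080706050403), (19, 12041009070806051103), (19,
    12041009060807051103)]),
  ([31012, 40809, 60708, 30509, 20506, 10211], 6071109101204080305, [(20, 7050609120310041108),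
    (1, 12111009080706050403), (3, 10111209080706050403), (20, 7050609100312041108), (20,
    12041009060807051103), (20, 12041009070806051103), (0, 12111009080706050403)]),
  ([31012, 40809, 60708, 30509, 20506, 105, 211, 10207], 4080503070610121109, [(21,
    7050609100312041108), (21, 7050609120310041108), (0, 8070403101106051209), (0,
    8070403121106051009)]),
  ([31012, 40809, 60708, 30509, 20506, 105, 211, 40711], 7110506091210080403, [(22,
    11050709100312080604), (22, 11050709120310080604), (22, 12081009110407050603), (0,
    12111009080706050403)]),
  ([31012, 40809, 60708, 30509, 20506, 105, 211, 10210], 9041107081210060503, [(2,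
    12101108090305060407), (5, 11101207090305060408), (23, 12041009070806051103), (0,
    12111009080706050403)]),
  ([31012, 40809, 60708, 30509, 20506, 105, 211], 12051006030809071104, [(1,
    12111009080706050403), (24, 12041009070806051103), (0, 10111209080706050403)]),
  ([31012, 40809, 60708, 30509, 20506, 105], 11050906070312080410, [(25, 12041009060807051103),
    (19, 12111009080706050403), (0, 12111009080706050403), (4, 12111009080706050403)]),
  ([31012, 40809, 60708, 30509, 20506], 5110906070312080410, [(26, 12041009070806051103), (26,
    12041009060807051103), (20, 12111009080706050403), (5, 12111009080706050403), (14,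
    12111009080706050403), (0, 12111009080706050403)]),
  ([31012, 60708, 30509, 10212, 207, 106, 50711], 8060903071110120504, [(27, 8090605100312110407),
    (27, 8090605120310110407), (0, 12041005070608091103), (0, 12041005070806091103)]),
  ([31012, 40809, 60708, 30509, 10212, 106, 30711], 8041210050703060911, [(28,
    12041009060807051103), (28, 9110407120310060508), (28, 9110407100312060508), (28,
    8090603120504111007), (28, 8090603100504111207), (0, 12041005070806091103)]),
  ([31012, 40809, 60708, 30509, 10212, 207, 106], 9041210080603050711, [(0, 12111009080706050403),
    (1, 12111009080706050403)]),
  ([31012, 40809, 60708, 30509, 10212, 207], 6070503080410120911, [(30, 7050609100312041108), (30,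
    7050609120310041108), (3, 12111009080706050403), (0, 12111009080706050403)]),
  ([31012, 40809, 60708, 30509, 10212, 106], 7060503080412100911, [(31, 7050609120310041108), (31,
    7050609100312041108), (4, 12111009080607050403), (4, 12111009080706050403), (0,
    12111009080706050403)]),
  ([31012, 40809, 60708, 30509, 10212], 7060503080410120911, [(32, 7050609100312041108), (32,
    7050609120310041108), (5, 12111009080607050403), (5, 12111009080706050403), (0,
    12111009080607050403), (1, 12111009080706050403)]),
  ([31012, 40809, 60708, 30509, 210, 112], 7060503080410120911, [(33, 7050609100312041108), (33,
    7050609120310041108), (6, 12111009080607050403), (6, 12111009080706050403), (0,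
    6110709031210040508), (0, 7110609031210040508)]),
  ([31012, 40809, 60708, 30509, 210], 12100408030506070911, [(34, 12041009060807051103), (34,
    12041009070806051103), (7, 7110609031012040508), (0, 12111009080706050403), (1,
    12111009080706050403)]),
  ([31012, 40809, 60708, 30509, 110], 7060503080410120911, [(35, 7050609100312041108), (35,
    7050609120310041108), (8, 12111009080607050403), (8, 12111009080706050403), (2,
    6110709031210040508), (0, 6110709031210040508), (2, 7110609031210040508)]),
  ([31012, 40809, 60708, 30509], 7060503080412100911, [(36, 7050609120310041108), (36,
    7050609100312041108), (9, 12111009080607050403), (9, 12111009080706050403), (3,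
    6110709031210040508), (0, 6110709031210040508), (1, 6110709031210040508), (3,
    7110609031210040508)]),
  ([31012, 40809, 60708, 50810, 20407, 106], 4060811100703051209, [(0, 7110609031210040508), (0,
    7110609121003040508), (0, 9110407121003060508), (0, 9110407031210060508), (0,
    11060710080904120503), (0, 9050407101203061108), (0, 9050406101203071108), (0,
    11070608101203090504)]),
  ([31012, 40809, 60708, 50810, 20407, 20306], 6071112100904030508, [(1, 7110609031210040508), (1,
    7110604031210090508), (1, 11040910080706030512), (1, 7050609101203041108), (1,
    9050407101203061108), (1, 11070610080904030512), (1, 11060710080904030512), (0,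
    12111009080706050403)]),
  ([31012, 40809, 60708, 50810, 20407, 10208, 206], 9041210110703060508, [(2,
    9110407031210060508), (2, 9110406031210070508), (2, 11070610080904120503), (2,
    11060710080904120503), (2, 11060710080904030512), (2, 9050407101203061108), (2,
    11090410080706030512), (2, 7050604101203091108), (0, 3111006080409050712), (1,
    12111006080409050703)]),
  ([31012, 40809, 60708, 50810, 20407, 10208], 6070305120910110408, [(3, 7050604101203091108), (3,
    11040910080706030512), (3, 7050609101203041108), (3, 7110609031210040508), (3,
    7110609121003040508), (3, 9110407121003060508), (3, 9110406031210070508), (3,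
    9110407031210060508), (1, 12111009080706050403), (2, 12111009080706050403), (0,
    12111009080706050403)]),
  ([31012, 40809, 60708, 50810, 20407, 104], 7081011090412030506, [(4, 9110406121003070508), (4,
    9110406031210070508), (4, 7110604121003090508), (4, 7110604031210090508), (4,
    11040910080706030512), (4, 11090410080706030512), (4, 7050604101203091108), (4,
    7050609101203041108), (4, 9050407101203061108), (0, 12111009080706050403)]),
  ([31012, 40809, 60708, 50810, 20407], 7081004110903120506, [(5, 9110406031210070508), (5,
    9110406121003070508), (5, 7110609031210040508), (5, 7110609121003040508), (5,
    11040910080706030512), (5, 11090410080706120503), (5, 11040910080706120503), (5,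
    7050609101203041108), (5, 7050604101203091108), (1, 12111009080706050403), (0,
    12111006080409050703)]),
  ([31012, 40809, 60708, 50810, 10204, 208, 106], 5100409110706031208, [(6, 11060710080904120503),
    (6, 11070610080904120503), (6, 11040908101203070506), (6, 11060708101203090504), (6,
    11040908101203060507), (6, 7050604101203091108), (6, 7050609101203041108)]),
  ([31012, 40809, 60708, 50810, 10204, 208], 6070911081004030512, [(7, 7110604121003090508), (7,
    7110604031210090508), (7, 7050604101203091108), (7, 7050609101203041108), (7,
    11040908101203070506), (7, 11040908101203060507), (1, 12111007080904050603), (1,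
    12111006080904050703), (0, 12111009080706050403)]),
  ([31012, 40809, 60708, 50810, 10204, 108, 206], 10120409110607030508, [(8, 9110406031210070508),
    (8, 9110407031210060508), (8, 11070610080904120503), (8, 11060710080904120503), (8,
    11040908101203060507), (8, 11070608101203090504), (8, 11040908101203070506), (8,
    11090410080706030512), (8, 11040910080706030512)]),
  ([31012, 40809, 60708, 50810, 10204, 108], 6070911081004030512, [(9, 7110604121003090508), (9,
    7110604031210090508), (9, 7050604101203091108), (9, 7050609101203041108), (9,
    11040908101203070506), (9, 11040908101203060507), (3, 12111007080904050603), (3,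
    12111006080904050703), (0, 12111009080706050403)]),
  ([31012, 40809, 60708, 50810, 10204], 8070411091012050603, [(10, 9110406031210070508), (10,
    9110406121003070508), (10, 7110609121003040508), (10, 11040910080706030512), (10,
    7050604101203091108), (10, 7050609101203041108), (10, 11040908101203060507), (10,
    11060708101203090504), (0, 12111009080706050403), (2, 12111009080706050403)]),
  ([31012, 40809, 60708, 50810, 209, 104], 6070411081009120503, [(11, 7110609031210040508), (11,
    7110609121003040508), (11, 7050609101203041108), (11, 7050604101203091108), (11,
    11070608101203090504), (11, 11060708101203090504), (5, 12111009080607050403), (5,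
    12111009080706050403), (0, 12111006080904050703), (0, 12111007080904050603)]),
  ([31012, 40809, 60708, 50810, 209], 4090611081007120503, [(12, 9110407031210060508), (12,
    9110407121003060508), (12, 9050407101203061108), (12, 9050406101203071108), (12,
    11070608101203090504), (12, 11040908101203070506), (6, 12111009080607050403), (0,
    12111009080706050403), (1, 12111009080706050403)]),
  ([31012, 40809, 60708, 50810, 107], 4070811100612050309, [(13, 7110609121003040508), (13,
    7110609031210040508), (13, 9110406031210070508), (13, 9110406121003070508), (13,
    11070610080904030512), (13, 9050406101203071108), (13, 9050407101203061108), (13,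
    11060708101203090504), (7, 12111009080706050403), (0, 12111004080706050903), (2,
    12111009080706050403)]),
  ([31012, 40809, 60708, 50810], 6070411081009030512, [(14, 7110609121003040508), (14,
    7110609031210040508), (14, 7050609101203041108), (14, 7050604101203091108), (14,
    11070608101203090504), (14, 11060708101203090504), (8, 12111009080607050403), (8,
    12111009080706050403), (3, 12111006080904050703), (0, 12111009080607050403), (1,
    12111006080904050703), (3, 12111007080904050603)]),
  ([31012, 40809, 60708, 70911, 10209, 207, 104], 6070903051204100811, [(15, 8050611101203090407),
    (0, 12051009080706110403), (15, 7110604101203090508), (15, 7110604031210090508), (15,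
    7110604121003090508), (15, 7110609121003040508), (15, 9110407031210060508), (15,
    7110609031210040508), (0, 12050308091107060410)]),
  ([31012, 40809, 60708, 70911, 10209, 207], 4080710090511120306, [(16, 8050411121003070609), (16,
    8050411031210070609), (16, 8040611031210090507), (16, 7110609121003040508), (16,
    8040611121003090507), (16, 8040611101203090507), (16, 9110407101203060508), (16,
    7110609101203040508), (1, 12051008071109040603), (0, 12111009080706050403)]),
  ([31012, 40809, 60708, 70911, 10209, 107], 8070905121103041006, [(17, 11050906031210080407),
    (17, 11050906101203080407), (17, 8050611101203090407), (17, 8050611121003090407), (17,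
    8050611031210090407), (17, 8040611031210090507), (17, 8040611121003090507), (17,
    9110407121003060508), (17, 7110609121003040508), (0, 12041009070806051103)]),
  ([31012, 40809, 60708, 70911, 10209], 8060910120407110305, [(18, 9110407031210060508), (18,
    8040611031210090507), (3, 12050308071109040610), (18, 8050611031210090407), (18,
    8050611121003090407), (3, 12051008071109040603), (3, 10051208071109040603), (3,
    10051208091107060403), (3, 12051008091107060403), (0, 12041009070806051103), (1,
    12041009070806051103)]),
  ([31012, 40809, 60708, 70911, 208, 107], 9081110120507060304, [(4, 12050308071109040610), (19,
    11050906031210080407), (19, 9110407031210060508), (19, 11040906031210080507), (19,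
    11040906121003080507), (19, 9110407101203060508), (19, 9110407121003060508), (19,
    8040611101203090507), (19, 8040611121003090507), (4, 10051209080706110403), (4,
    12051009080706110403), (0, 12111009080706050403)]),
  ([31012, 40809, 60708, 70911, 208], 9070803040612100511, [(20, 8040611121003090507), (20,
    8040611101203090507), (20, 11040906121003080507), (20, 11040906101203080507), (20,
    11050906101203080407), (20, 11050906121003080407), (20, 11050906031210080407), (5,
    12050308071109040610), (1, 12111007080904050603), (0, 12111007080904050603), (1,
    12111009080706050403)]),
  ([31012, 40809, 60708, 70911, 108], 7090803061110120504, [(21, 7110604101203090508), (21,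
    7110604121003090508), (21, 8040611101203090507), (21, 8040611121003090507), (21,
    8050411121003070609), (21, 8050411101203070609), (6, 12050309080706110410), (21,
    8050411031210070609), (6, 12050308091107060410), (2, 12111009080706050403), (0,
    12041008070911050603), (2, 12111007080904050603)]),
  ([31012, 40809, 60708, 70911], 8090705030612111004, [(22, 8050611121003090407), (22,
    8050611101203090407), (22, 8050411101203070609), (22, 8050411031210070609), (22,
    8050411121003070609), (22, 11040906121003080507), (22, 11040906031210080507), (22,
    7110609031210040508), (22, 9110407031210060508), (3, 12111009080706050403), (0,
    12111009080706050403), (1, 12111009080706050403), (3, 12061008090711050403)]),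
  ([31012, 40809, 60708, 20407, 106], 4060805030910111207, [(23, 9050407101203061108), (23,
    9050407121003061108), (23, 7050609121003041108), (23, 7050609031210041108), (23,
    7050609101203041108), (23, 7110609101203040508), (23, 7110609031210040508), (23,
    9110406031210070508), (8, 12110309080706050410), (0, 12071006040809110503)]),
  ([31012, 40809, 60708, 20609, 20407], 4091110120605030807, [(24, 9110407031210060508), (9,
    12110309080706050410), (24, 9110406031210070508), (24, 9110406101203070508), (24,
    9110406121003070508), (24, 9050406101203071108), (24, 9050406121003071108), (24,
    7050609121003041108), (24, 7050604101203091108), (24, 7050609101203041108), (0,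
    12111007080904050603)]),
  ([31012, 40809, 60708, 20609, 10208, 106], 9040705081012110603, [(25, 9050406031210071108), (25,
    9050406101203071108), (25, 9050406121003071108), (10, 12051009080706110403), (10,
    10051209080706110403), (10, 10111209080706050403), (25, 9110407101203060508), (10,
    12111009080706050403), (2, 12041009070806110503), (2, 12061007040809110503), (0,
    12111007080904050603)]),
  ([31012, 40809, 60708, 20609, 10208], 6070405091203110810, [(11, 12051009080706110403), (11,
    10051209080706110403), (11, 12050309080706110410), (26, 7050609121003041108), (26,
    7050609031210041108), (26, 7110609031210040508), (26, 7110604121003090508), (26,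
    7110609121003040508), (3, 12041009070806110503), (3, 12071006040809110503), (3,
    12061007040809110503), (1, 12111007080904050603), (0, 12111009080706050403)]),
  ([31012, 40809, 60708, 20609, 109], 6080405120903111007, [(27, 9050407031210061108), (27,
    9050407101203061108), (27, 7050609101203041108), (27, 7050609121003041108), (27,
    7050609031210041108), (27, 7110609031210040508), (27, 7110609121003040508), (12,
    10111209080706050403), (27, 7110604121003090508), (4, 12071006040809110503), (0,
    12111009080706050403)]),
  ([31012, 40809, 60708, 20609], 6080405100912110307, [(28, 9050407121003061108), (28,
    9050407031210061108), (28, 7050609031210041108), (28, 7050609101203041108), (28,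
    7050609121003041108), (28, 7110609121003040508), (28, 7110609101203040508), (13,
    12111009080706050403), (28, 7110604101203090508), (5, 12071006040809110503), (1,
    12111009080706050403), (0, 12111006080409050703)]),
  ([31012, 40809, 60708, 10209, 207, 104], 8060405090312110710, [(29, 9050407101203061108), (29,
    9050407031210061108), (29, 9050407121003061108), (29, 7050609031210041108), (29,
    7050609121003041108), (29, 7110609121003040508), (29, 7110604031210090508), (29,
    7110609031210040508), (6, 12041009060807110503), (6, 12071006040809110503), (0,
    12111006080904050703)]),
  ([31012, 40809, 60708, 10209, 207], 4080705030610111209, [(30, 7050609101203041108), (30,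
    7050609121003041108), (30, 9050406121003071108), (30, 9050406031210071108), (30,
    9050406101203071108), (30, 9110406101203070508), (30, 9110406031210070508), (15,
    12110309080706050410), (30, 9110407031210060508), (7, 12061007040809110503), (0,
    12111009080706050403)]),
  ([31012, 40809, 60708, 10209, 107], 6080405030910111207, [(31, 9050407101203061108), (31,
    9050407121003061108), (31, 7050609121003041108), (31, 7050609031210041108), (31,
    7050609101203041108), (31, 7110609101203040508), (31, 7110609031210040508), (16,
    12110309080706050410), (31, 7110604031210090508), (8, 12071006040809110503), (2,
    12111006080904050703), (0, 12111009080607050403)]),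
  ([31012, 40809, 60708, 10209], 7060904110308100512, [(17, 10111209080706050403), (17,
    12110309080706050410), (17, 12111009080706050403), (17, 12051009080706110403), (17,
    12050309080706110410), (32, 7050609031210041108), (32, 7050604031210091108), (9,
    12041009060807051103), (9, 12071006040809051103), (0, 12111009080706050403), (1,
    12111009080706050403)]),
  ([31012, 40809, 60708, 207, 104], 9040705081003061112, [(33, 9050406121003071108), (33,
    9050406101203071108), (33, 9050406031210071108), (18, 12110309080706050410), (33,
    9110407101203060508), (18, 12111009080706050403), (10, 12041009070806110503), (10,
    12061007040809110503), (0, 12111009080706050403)]),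
  ([31012, 40809, 60708, 207], 4090706051208031110, [(19, 12051009080706110403), (19,
    10051209080706110403), (19, 12050309080706110410), (19, 12110309080706050410), (19,
    10111209080706050403), (34, 9110407121003060508), (34, 9110406121003070508), (11,
    12041009070806110503), (11, 12041009060807110503), (1, 12111009080706050403), (0,
    12111009080706050403), (1, 12111004080706050903)]),
  ([31012, 40809, 60708, 104], 7040605081203110910, [(35, 7050609101203041108), (35,
    7050609121003041108), (35, 7050609031210041108), (20, 10051209080706110403), (20,
    12050309080706110410), (20, 12110309080706050410), (35, 9110406121003070508), (20,
    10111209080706050403), (12, 12061007040809110503), (12, 12071006040809110503), (6,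
    12111006080904050703), (6, 12111007080904050603), (0, 12111009080706050403), (2,
    12111007080904050603)]),
  ([31012, 40809, 60708], 9040711080306051012, [(36, 9110406121003070508), (36,
    9110406101203070508), (21, 12110309080706050410), (36, 9110406031210070508), (36,
    9050406031210071108), (36, 9050407031210061108), (21, 12050309080706110410), (13,
    12041009070806051103), (13, 12061007040809051103), (7, 12111009080607050403), (7,
    12111007080904050603), (3, 12111004080706050903), (0, 12111004080706050903), (1,
    12111007080904050603), (3, 12111009080706050403)]),
  ([31012, 40809, 70912, 20304, 50910, 10212, 104], 3100504080711061209, [(0,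
    12071011090804050603), (0, 12071108091005030406), (0, 8110712100905040306), (0,
    11070812100905040306), (0, 11080712100905040306), (0, 11080712100905060304), (0,
    11060812100905040307), (0, 12111007040908060503), (0, 12111007080904060503)]),
  ([31012, 40809, 70912, 50607, 20304, 50910, 10212], 4081211090607100305, [(1,
    12071108091005030406), (1, 12071011090804050603), (1, 12081107051009030604), (1,
    12041107051009030608), (0, 12111009080706050403)]),
  ([31012, 40809, 70912, 50607, 20304, 50910, 10410], 4120710050306110809, [(2,
    12071011090804050603), (2, 8110612091005040703), (2, 11060812091005040703), (2,
    11070812100905040306), (2, 11100508091207060403), (2, 11100608091207050403), (0,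
    12111009080706050403)]),
  ([31012, 40809, 70912, 50607, 20304, 50910, 103], 4120703061011050809, [(3,
    11041012070605030908), (3, 11060810120907040305), (3, 11100608091207050403), (3,
    11051008091207030406), (1, 12111009080706050403), (0, 10111209080506070403)]),
  ([31012, 40809, 70912, 50607, 20304, 50910], 3120706100911080504, [(4, 11080510120907060304),
    (4, 11060810120907040305), (4, 11041012070605030908), (4, 11051008091207030406), (4,
    12071011090804050603), (2, 12111009080706050403), (0, 12111009080706050403)]),
  ([31012, 40809, 70912, 50607, 103, 20508], 8031009070406110512, [(5, 9070811121003050604), (5,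
    9070811121003060504), (5, 11080510120907060304), (5, 12091011070605080403), (5,
    11080610120907050304), (0, 4110907061003120508)]),
  ([31012, 40809, 70912, 50607, 20304, 10209, 103], 4080511091206100703, [(1,
    10111209080605070403), (6, 12071011090804050603), (6, 9070811121003050604), (6,
    9070811121003060504), (6, 12071011090804060503), (6, 11080510120907060304), (6,
    11060810120907040305), (0, 12111009080706050403)]),
  ([31012, 40809, 70912, 50607, 20304, 10209], 3120711080405060910, [(2, 10111209080506070403),
    (2, 10111209080605070403), (7, 11060810120907040305), (7, 11080510120907060304), (7,
    12091011070605080403), (7, 7090611121003040805), (7, 12061011080904050703), (7,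
    9120811070605100304), (0, 12111009080706050403)]),
  ([31012, 40809, 70912, 50607, 20304, 104], 3120705100911040608, [(8, 11050810120907040306), (8,
    12071011090804050603), (8, 11080610120907050304), (8, 11081012070605030904), (8,
    11061008091207030405), (8, 12071011090804060503), (8, 7080611101203040905), (3,
    10111209080506070403), (0, 9110812100706050304)]),
  ([31012, 40809, 70912, 50607, 20304], 3120711100906050408, [(4, 10111209080506070403), (9,
    11051008091207030406), (9, 12071011090804050603), (4, 10111209080605070403), (9,
    7080611101203040905), (9, 9060811101203050704), (9, 9120811070605100304), (1,
    9110812100706050304), (0, 9110812100706050304)]),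
  ([31012, 40809, 70912, 50607, 10203, 206, 108], 7090310080411050612, [(10, 9070811121003060504),
    (10, 9070811121003050604), (10, 11080610120907050304), (10, 11060810120907040305), (10,
    11080510120907060304), (10, 11041012070605030908), (10, 11081012070605030904)]),
  ([31012, 40809, 70912, 50607, 10203, 206], 8040506091211100703, [(11, 9120811070605100304), (11,
    9060811101203050704), (11, 7080611101203040905), (11, 12071011090804050603), (11,
    9070811121003050604), (1, 7110609041210030805), (1, 9110807061210030504), (0,
    12111009080706050403)]),
  ([31012, 40809, 70912, 50607, 10203, 108], 4080506091211030710, [(12, 9060811101203050704), (12,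
    9120811070605100304), (12, 7120611090804100305), (12, 12071011090804050603), (12,
    9070811121003050604), (2, 9110807061210030504), (2, 7110609041210030805), (0,
    12111007060904080503)]),
  ([31012, 40809, 70912, 50607, 10203], 8041003090711061205, [(13, 9070811121003060504), (13,
    9070811121003050604), (13, 12071011090804050603), (13, 7120611090804100305), (13,
    9120811070605100304), (3, 9110412030706051008), (3, 9110812030706051004), (0,
    12111009080706050403), (1, 12111007060908040503)]),
  ([31012, 40809, 70912, 50607, 206, 108], 4080310090711051206, [(14, 9070811121003050604), (14,
    9070811121003060504), (14, 12071011090804060503), (14, 7080611101203040905), (14,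
    9060811101203050704), (4, 12111009080706050403), (4, 12111009040706050803), (0,
    9110812100706050304)]),
  ([31012, 40809, 70912, 50607, 206], 4080605091211030710, [(15, 9060811101203050704), (15,
    9120811070605100304), (15, 7120611090804100305), (15, 12071011090804060503), (15,
    9070811121003060504), (1, 9110412100706050308), (0, 12111009040706050803), (1,
    9110812100706050304)]),
  ([31012, 40809, 70912, 50607, 108], 4080310090711051206, [(16, 9070811121003050604), (16,
    9070811121003060504), (16, 12071011090804060503), (16, 7080611101203040905), (16,
    9060811101203050704), (6, 12111009080706050403), (6, 12111009040706050803), (0,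
    12111007060904080503), (2, 9110812100706050304)]),
  ([31012, 40809, 70912, 50607], 4080310090711051206, [(17, 9070811121003050604), (17,
    9070811121003060504), (17, 12071011090804060503), (17, 7080611101203040905), (17,
    9060811101203050704), (7, 12111009080706050403), (7, 12111009040706050803), (3,
    9110412100706050308), (0, 12111009040706050803), (1, 12111007060904080503), (3,
    9110812100706050304)]),
  ([31012, 40809, 70912, 20412, 10812, 20508], 8040611120507100309, [(18, 9110807031210060504),
    (18, 9110807101203060504), (0, 7061112100908040305), (18, 11080610120907040305), (18,
    9110806121003070504), (18, 9070811121003060504), (18, 9070811121003050604), (18,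
    11050810120907040306), (18, 11080610120907050304)]),
  ([31012, 40809, 70912, 20412, 10812, 10206], 12050806110703100904, [(19, 9060811101203050704),
    (19, 11100608091207050403), (19, 9110807031210050604), (19, 9060811031210050704), (19,
    12111007080904050603), (19, 12061011080904050703), (5, 7051112100908040306), (19,
    11060810120907040305), (19, 11080610120907040305), (19, 11050810120907040306), (19,
    9110806121003070504), (19, 8110610120907040305), (0, 12111009080706050403)]),
  ([31012, 40809, 70912, 20412, 10812], 12050804061107031009, [(20, 9060811101203050704), (20,
    11100608091207050403), (20, 9110807031210050604), (20, 9060811031210050704), (20,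
    12111007040908050603), (20, 12061011040908050703), (2, 7051112100908040306), (20,
    11050810120907040306), (20, 11080610120907050304), (20, 8110610120907040305), (20,
    6110510120907080304), (1, 12111009080706050403), (0, 12111009080705060403)]),
  ([31012, 40809, 70912, 20412, 103, 60812], 4031005070611091208, [(21, 12071011090804050603),
    (21, 11090710120806040305), (21, 11080610120907040305), (4, 7051112030908041006), (21,
    10110608091207030405), (21, 9110807101203050604), (4, 7110612030908041005), (21,
    7110509081206100403), (21, 10110709081206030405), (21, 5110409120806100703), (21,
    10110509120806030704)]),
  ([31012, 40809, 70912, 20412, 103], 4031008091211060507, [(5, 7051112030908041006), (5,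
    7061112030908041005), (5, 7110612030908041005), (22, 9070811121003060504), (22,
    9110806121003070504), (22, 11080610120907040305), (22, 12071011090804050603), (22,
    9070811121003050604), (0, 12061008091107050403)]),
  ([31012, 40809, 70912, 20412, 10208, 210], 3100804120711050609, [(23, 12071011090804060503),
    (23, 12071011090804050603), (23, 12111006090804070503), (9, 9050407111210030608), (9,
    9110407061210030508), (23, 11080610120907040305), (23, 9070811121003060504), (9,
    9060407111210030508), (23, 12061011040908050703), (0, 12111009080706050403)]),
  ([31012, 40809, 70912, 20412, 10208], 10030409120611070805, [(10, 9060407111210030508), (24,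
    11060810120907040305), (24, 12111007080904060503), (24, 11050810120907040306), (24,
    12111007080904050603), (24, 12061011080904050703), (10, 9050407111210030608), (24,
    12071011090804050603), (24, 9070811121003050604), (1, 12110309080706050410), (0,
    12111009080706050403)]),
  ([31012, 40809, 70912, 20412, 112, 30609], 4080312090506110710, [(25, 11051008091207030406),
    (25, 9110807101203050604), (25, 11121008090603050407), (8, 6110703120908041005), (25,
    11080712030906041005), (8, 6051103120908041007), (25, 12071011090804060503), (25,
    11080610120907040305), (25, 9110806121003070504), (2, 3111009040607050812), (0,
    12111009080706050403)]),
  ([31012, 40809, 70912, 112, 20810], 8120304091007110605, [(8, 7061112100908040305), (8,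
    7110612100908040305), (26, 11080610120907040305), (26, 9110807101203050604), (26,
    11051008091207030406), (8, 7051112100908040306), (3, 10070309041106050812), (26,
    9060811101203050704), (3, 10110304090706050812)]),
  ([31012, 40809, 70912, 20412, 112], 4080312090611050710, [(27, 11061008091207030405), (27,
    9060811101203050704), (27, 9110807101203060504), (9, 7051112100908040306), (9,
    7110612100908040305), (9, 7061112100908040305), (27, 12111006090804070503), (27,
    12071011090804060503), (27, 11080610120907040305), (27, 9070811121003050604), (27,
    12071011090804050603), (1, 12111009080706050403), (0, 12110309080706050410), (2,
    12111009080706050403)]),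
  ([31012, 40809, 70912, 20412], 12080903100711050406, [(28, 11080610120907040305), (28,
    11080610120907050304), (28, 6110510120907080304), (28, 12061011040908050703), (28,
    12111007040908060503), (28, 11080510120907060304), (28, 9110807101203060504), (28,
    11061008091207030405), (10, 7061112100908040305), (28, 9060811031210050704), (28,
    9060811101203050704), (3, 12111009080706050403), (7, 12111009080706050403), (0,
    12111009080706050403)]),
  ([31012, 40809, 70912, 10204, 210, 103], 9031204080705110610, [(29, 11061008091207030405), (29,
    10110608091207030405), (29, 11051008091207030406), (15, 9110807061210030504), (15,
    9050807111210030604), (29, 11080610120907040305), (29, 12061011080904050703), (29,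
    11060810120907040305), (15, 9060807111210030504), (29, 12111007040908060503), (29,
    12111007080904060503), (0, 9110812100706050304)]),
  ([31012, 40809, 70912, 30609, 10204, 210], 12030804101105070609, [(30, 11080610120907040305),
    (16, 9050807111210030604), (16, 9110807061210030504), (30, 11121008090603050407), (30,
    10120708090603110405), (30, 11080712030906041005), (30, 10110512090603080704), (30,
    11080510120907060304), (30, 11061008091207030405), (30, 11051012090603040708), (30,
    11081012090603050704), (1, 12111009040706050803), (1, 3111209040607050810), (0,
    3111009080607050412)]),
  ([31012, 40809, 70912, 30609, 10204, 110], 12100408110605030709, [(17, 9110807061210030504),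
    (31, 9110807031210060504), (31, 11100508091207060403), (31, 11060810120907040305), (31,
    8110610120907040305), (31, 11080610120907040305), (31, 11080610120907050304), (31,
    11050810120907040306), (31, 11081012090603050704), (31, 11051012090603040708), (1,
    3111209080607050410)]),
  ([31012, 40809, 70912, 30609, 10204], 10120408070605091103, [(32, 11100508091207060403), (32,
    11080610120907040305), (32, 12071011090804060503), (32, 8110712030906041005), (32,
    8110610120907040305), (18, 9110807061210030504), (32, 12111007040908050603), (32,
    12111007080904050603), (0, 12111009080706050403), (1, 12111009080706050403)]),
  ([31012, 40809, 70912, 30609, 208, 104], 12040910030711060508, [(33, 11050810120907040306), (33,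
    11060810120907040305), (33, 8110610120907040305), (33, 11080712030906041005), (17,
    7110612100908040305), (33, 11080610120907040305), (17, 7051112100908040306), (33,
    11121008090603050407), (33, 9060811031210050704), (4, 12111009080706050403), (3,
    9110803100607051204)]),
  ([31012, 40809, 70912, 30609, 208], 4080312090506110710, [(34, 11051008091207030406), (34,
    9110807101203050604), (34, 11121008090603050407), (18, 7110612100908040305), (34,
    11080712030906041005), (18, 7051112100908040306), (34, 12071011090804060503), (34,
    11080610120907040305), (34, 9110806121003070504), (5, 3111209080607050410), (0,
    12111009080706050403), (1, 12111009080706050403)]),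
  ([31012, 40809, 70912, 30609, 104], 8041203090511070610, [(35, 11121008090603050407), (35,
    11051008091207030406), (35, 9110807101203050604), (35, 11080610120907040305), (18,
    7110609041210030805), (18, 7051109041210030806), (35, 11080712030906041005), (35,
    11100508091207060403), (35, 12071011090804060503), (6, 12111009040706050803), (6,
    12111009080706050403), (0, 12111009080706050403), (2, 12111009040706050803)]),
  ([31012, 40809, 70912, 30609], 8040310090706051112, [(36, 9110806121003070504), (36,
    9070811121003050604), (36, 12101108090603070405), (18, 7051112100908040306), (36,
    11080712030906041005), (36, 11080610120907040305), (18, 7110612100908040305), (36,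
    9110807101203050604), (7, 3111209040607050810), (7, 3111209080607050410), (3,
    12111009080706050403), (0, 12111009040706050803), (1, 12111009080706050403), (3,
    12111009040706050803)]),
  ([31012, 40809, 70912, 10203, 208], 4081203090510110706, [(37, 11051008091207030406), (37,
    9110807101203050604), (23, 12051007110908040603), (37, 9110807101203060504), (23,
    12061007110908040503), (37, 9060811101203050704), (37, 12071011090804060503), (0,
    10060309081107050412), (37, 11061008091207030405), (0, 10110309080507060412), (0,
    3111009080507060412), (8, 12111009080706050403), (7, 9110812100706050304)]),
  ([31012, 40809, 70912, 10203, 108], 4091206080711051003, [(38, 11100508091207060403), (38,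
    9060811101203050704), (38, 9110807101203060504), (38, 11061008091207030405), (38,
    12111007080904060503), (38, 11060810120907040305), (24, 12061007110908040503), (38,
    11050810120907040306), (24, 12051007110908040603), (38, 12061011080904050703), (38,
    12111007080904050603), (1, 8110412100607050309), (1, 4110812100607050309), (9,
    12111009080706050403), (0, 12111009040706050803)]),
  ([31012, 40809, 70912, 10203], 8091206041107051003, [(39, 9110807031210060504), (39,
    9060811101203050704), (39, 11061008091207030405), (39, 9110807101203060504), (39,
    11080510120907060304), (39, 12111007040908060503), (25, 12061007110908040503), (39,
    12111007040908050603), (25, 12051007110908040603), (39, 12061011040908050703), (39,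
    9070811121003050604), (2, 4060812101107050309), (39, 11080610120907050304), (2,
    4110812100607050309), (2, 8110412100607050309), (10, 12111009040706050803), (0,
    12111009080706050403), (1, 12111009080706050403)]),
  ([31012, 40809, 70912, 203, 104], 8041203091107100506, [(40, 9110807101203050604), (24,
    7110609081203100405), (40, 10110608091207030405), (24, 7061109081203100405), (40,
    11061008091207030405), (40, 9110807101203060504), (3, 10060309081107050412), (40,
    9060811101203050704), (40, 9060811031210050704), (3, 3061009081107050412), (11,
    12111009040706050803), (11, 12111009080706050403), (0, 9110412100706050308)]),
  ([31012, 40809, 70912, 203], 8040312090510071106, [(41, 9110807101203050604), (41,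
    11051008091207030406), (25, 7051109081203100406), (41, 11061008091207030405), (25,
    7061109081203100405), (41, 9060811101203050704), (41, 9110807101203060504), (4,
    10110309080507060412), (4, 3111009080507060412), (1, 9110812100706050304), (0,
    12111009040706050803), (1, 9110412100706050308)]),
  ([31012, 40809, 70912, 108], 10030905120406070811, [(25, 7051109081210030406), (42,
    11050810120907040306), (42, 12061011080904050703), (42, 12111007080904050603), (42,
    12111007040908050603), (42, 9110806121003070504), (42, 6110510120907080304), (5,
    4110812100607050309), (5, 4110812100507060309), (5, 10110309080507060412), (5,
    3111009080507060412), (13, 9110812030706051004), (13, 9110812100706050304), (2,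
    12111009080706050403), (0, 12110309080706050410), (2, 12110309080706050410)]),
  ([31012, 40809, 70912], 10030911060412070508, [(6, 8110412100507060309), (43,
    12111007080904060503), (6, 4110812100507060309), (43, 12111007040908060503), (43,
    12111007040908050603), (43, 9070811121003050604), (6, 4060812101107050309), (6,
    4110812100607050309), (43, 11080610120907050304), (6, 3111009080607050412), (43,
    11100608091207050403), (43, 12071011090804050603), (6, 10060309081107050412), (6,
    3061009081107050412), (14, 9110812030706051004), (14, 9110812100706050304), (3,
    12111009080706050403), (0, 9110812100706050304), (1, 12110309080706050410), (3,
    12110309080706050410)]),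
  ([31012, 40809, 20710, 112], 7120306081110050904, [(0, 10111204090507060803), (0,
    10071209081106050403), (44, 12071011090804060503), (0, 10111209080507060403), (44,
    12071011080904060503), (0, 10111208090507060403), (44, 9070811101203060504), (0,
    10111208090607050403), (44, 9070811101203050604), (0, 10071208091106050403), (44,
    9070811031210050604), (0, 8070903121106051004), (44, 12071011080904050603), (0,
    12111008090607050403), (0, 8110903120607051004), (44, 9110807121003050604), (44,
    9110807031210050604)]),
  ([31012, 40809, 20710, 20412], 12101108050407030609, [(1, 9110803120706051004), (45,
    12111007090804050603), (1, 9110803120607051004), (45, 12111007040908050603), (1,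
    4110903120607051008), (45, 9110807031210050604), (1, 4110903120507061008), (45,
    9110807031210060504), (1, 4110903120706051008), (45, 12111007080904060503), (45,
    12111007040908060503), (45, 12071011040908060503), (45, 9070811101203060504), (1,
    10111208090507060403), (45, 12071011080904060503), (1, 12071008091106050403), (1,
    10071208091106050403), (0, 12111009080706050403)]),
  ([31012, 40809, 20710, 104], 7041210060811090305, [(46, 12071011090804060503), (46,
    9070811031210060504), (2, 9110803120507061004), (2, 8070903121106051004), (2,
    9070803121106051004), (46, 12071011090804050603), (46, 9070811101203050604), (2,
    10071208091106050403), (46, 12071011080904050603), (2, 12111008090607050403), (2,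
    10111208090607050403), (2, 12111004090607050803), (2, 10111204090607050803), (0,
    12111009080706050403), (2, 12111004090706050803)]),
  ([31012, 40809, 20710, 10212, 203], 8040712030506091011, [(47, 12071011090804050603), (47,
    9070811101203050604), (3, 10071209081106050403), (47, 9110806101203070504), (3,
    10111209080507060403), (3, 10111209080607050403), (3, 9110803120507061004), (3,
    9110803120607051004), (47, 12111006090804070503), (47, 9110806121003070504), (47,
    9110806031210070504), (47, 9110807121003060504), (47, 9110807031210060504), (3,
    4110903120706051008), (3, 12111008090706050403), (3, 12111004090706050803), (0,
    12111009040706050803)]),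
  ([31012, 40809, 20710, 10212], 3100408061112090507, [(4, 12111009080706050403), (48,
    9110807121003060504), (48, 12111007090804060503), (48, 9070811121003060504), (48,
    12071011090804060503), (4, 12111009080507060403), (48, 12071011090804050603), (4,
    12111009080607050403), (4, 12071009081106050403), (4, 12111008090607050403), (4,
    12071008091106050403), (48, 9070811121003050604), (48, 12071011040908050603), (48,
    12071011080904050603), (4, 10111204090607050803), (4, 10111208090607050403), (2,
    3111009080706050412), (3, 3111009080706050412), (0, 12111009080706050403)]),
  ([31012, 40809, 20710, 10712], 7030804111209061005, [(49, 12111006090804070503), (5,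
    10111209080507060403), (49, 9110806101203070504), (5, 10111209080607050403), (49,
    9070811121003050604), (49, 12071011090804050603), (5, 12111009080607050403), (5,
    12071009081106050403), (5, 12071008091106050403), (5, 12071004091106050803), (5,
    8070903121106051004), (5, 4070903121106051008), (5, 4110903120706051008), (3,
    3111009040706050812), (5, 8110903120706051004), (0, 3111009080706050412)]),
  ([31012, 40809, 20710, 110], 7030508120906041011, [(50, 12071011040908050603), (50,
    9070811101203050604), (6, 10071204091106050803), (6, 10111209080607050403), (6,
    10111204090607050803), (6, 12111004090607050803), (6, 12111008090607050403), (6,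
    12111009080607050403), (6, 12111009080507060403), (6, 12111008090507060403), (6,
    8110903120706051004), (50, 12111007080904060503), (6, 8110903120507061004), (5,
    10110309080507060412), (50, 9110807031210060504), (1, 3111009080706050412), (0,
    3111009080706050412)]),
  ([31012, 40809, 20710], 10030811040612050907, [(51, 9110807121003060504), (7,
    12111009080706050403), (51, 12111007090804060503), (7, 12111009080607050403), (51,
    12111006090804070503), (7, 12111009080507060403), (51, 12111006040908070503), (7,
    12111004090507060803), (51, 9110806121003070504), (7, 12071004091106050803), (51,
    9070811121003050604), (7, 12111004090607050803), (51, 12071011080904050603), (51,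
    12071011040908050603), (7, 4070903121106051008), (7, 10071208091106050403), (7,
    8070903121106051004), (5, 3111009040706050812), (2, 3111009080706050412), (0,
    12111009080706050403)]),
  ([31012, 40809, 10204, 203, 112], 7121004050806090311, [(52, 12071011090804050603), (52,
    9070811031210050604), (8, 9070803121106051004), (8, 8110903120607051004), (8,
    9110803120607051004), (52, 12111006090804070503), (52, 12111006040908070503), (52,
    12111006080904070503), (8, 10111208090507060403), (8, 12111004090507060803), (8,
    10111204090507060803), (8, 12111004090706050803), (8, 10111204090706050803), (0,
    12111009080706050403), (0, 10111209080706050403)]),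
  ([31012, 40809, 10204, 203], 10120407090608031105, [(9, 8110903120507061004), (53,
    12071011080904060503), (53, 9070811031210060504), (53, 12071011080904050603), (53,
    9070811031210050604), (9, 8070903121106051004), (9, 9110803120607051004), (9,
    8110903120607051004), (53, 12111007080904050603), (53, 12111007040908050603), (53,
    12111007090804050603), (9, 12111009080706050403), (9, 10111204090706050803), (9,
    12111004090706050803), (0, 10111209080706050403)]),
  ([31012, 40809, 10204, 112], 10121104030709050806, [(54, 12111006090804070503), (54,
    12111006080904070503), (54, 12111007080904060503), (54, 9110807031210060504), (10,
    9110803120507061004), (54, 12111007090804060503), (10, 9110803120706051004), (54,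
    12061011040908050703), (54, 9060811031210050704), (10, 4110903120706051008), (10,
    4070903121106051008), (10, 10071204091106050803), (10, 12071004091106050803), (2,
    12071009081106050403), (2, 10071209081106050403), (0, 12110309080706050410)]),
  ([31012, 40809, 10204], 3100408071112090605, [(11, 12111009080507060403), (55,
    9110806121003070504), (55, 12111006090804070503), (55, 9070811121003050604), (55,
    12071011090804050603), (11, 12111009080607050403), (55, 12061011090804050703), (11,
    12111009080706050403), (11, 12071009081106050403), (11, 12111008090706050403), (11,
    12071008091106050403), (55, 9060811121003050704), (55, 12061011040908050703), (55,
    12061011080904050703), (11, 10111204090706050803), (11, 10111208090706050403), (0,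
    3111209080706050410), (1, 12111009080706050403)]),
  ([31012, 40809, 209, 103], 4091107031008050612, [(12, 12111008090507060403), (12,
    12111008090607050403), (56, 9110806121003070504), (12, 10111208090607050403), (56,
    9110806101203070504), (56, 12111006080904070503), (12, 8110903120507061004), (12,
    10111208090507060403), (12, 8110903120706051004), (12, 10111208090706050403), (56,
    9060811101203050704), (12, 9070803121106051004), (12, 9110803120706051004), (56,
    9060811031210050704), (56, 12061011040908050703), (56, 12061011090804050703), (4,
    9070412101106050308), (0, 12111009080706050403)]),
  ([31012, 40809, 209], 10121105040903070806, [(57, 9110807031210050604), (13,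
    8110903120607051004), (57, 12111007080904050603), (13, 8110903120706051004), (13,
    4110903120706051008), (13, 9110803120706051004), (13, 4110903120507061008), (13,
    9110803120507061004), (57, 12071011090804060503), (13, 12071004091106050803), (13,
    12111004090507060803), (57, 12071011040908060503), (57, 9070811101203060504), (57,
    9070811121003060504), (5, 12071009081106050403), (5, 10071209081106050403), (1,
    9110810030706051204), (0, 12110309080706050410), (1, 9110812030706051004)]),
  ([31012, 40809, 103], 4081106120903070510, [(58, 9110807101203060504), (14,
    9110803120507061004), (58, 12111007090804060503), (58, 9110807031210060504), (14,
    12111009080706050403), (14, 9110803120706051004), (14, 9110803120607051004), (58,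
    12071011090804050603), (14, 12071009081106050403), (14, 12111009080607050403), (14,
    12071008091106050403), (14, 12111008090607050403), (58, 9070811121003050604), (58,
    12071011040908050603), (58, 12071011080904050603), (6, 9070412101106050308), (6,
    9070812101106050304), (2, 12111009040706050803), (0, 12111004090706050803), (2,
    12111009080706050403)]),
  ([31012, 40809], 4090610081112050307, [(59, 9110807121003060504), (59, 9110807031210060504),
    (59, 9070811031210060504), (59, 12071011080904060503), (15, 12111008090507060403), (59,
    9070811121003060504), (15, 12071008091106050403), (59, 9070811101203050604), (59,
    12071011080904050603), (15, 10071208091106050403), (15, 10111208090607050403), (15,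
    10111204090607050803), (15, 10111209080607050403), (7, 9110412100607050308), (7,
    8110912100607050304), (3, 12111008040706050903), (0, 9110812100706050304), (1,
    12111004090706050803), (3, 12111009080706050403)]),
  ([31012, 50812, 60912, 20509, 110], 5101207080911060403, [(0, 11100612080907040503), (0,
    11100412080907060503), (0, 6110412081009070503), (0, 11080912100706050304), (0,
    11090612100807050304), (0, 11090812100705040306), (0, 11090812100605040307), (0,
    11080912100605040307), (0, 11070912100605040308), (0, 9110812100605040307), (0,
    10110812090504030607), (0, 10110712090804030605)]),
  ([31012, 50812, 60912, 20509, 10212, 20810], 9061011081203070504, [(1, 7110412081009060503), (1,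
    5110412091008070603), (1, 7110512100908060304), (1, 7110512091008040603), (1,
    8110712091005040603), (1, 11100812090705040603), (1, 11090812100705040306), (1,
    11071012080604030509), (1, 11091012080704030506), (0, 12110908030705100406)]),
  ([31012, 50812, 60912, 20509, 10212, 105], 9060304070810111205, [(2, 11081012090704030605), (2,
    11090812100605040307), (2, 11091012080604030507), (2, 11071012090504030608), (2,
    10110712080906030504), (2, 10110812090705030604), (2, 10110812090504030607), (2,
    8110412091007050603), (2, 8110712091005040603), (2, 8110712100906050304), (2,
    7110612081009040503), (2, 7110612100908050304), (2, 7110412081009060503), (2,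
    9110412081007060503), (2, 6110412081009070503), (0, 12110503090710060408)]),
  ([31012, 50812, 60912, 20509, 10212], 5080311120610040709, [(3, 10110912080706030504), (3,
    10110912080604030507), (3, 9110712100806050304), (3, 10110712080904030506), (3,
    7110612100908050304), (3, 10110712080906030504), (3, 10110612080907030504), (3,
    11091012080704030506), (3, 11100612080907040503), (3, 11100512090807040603), (3,
    11100812090705040603), (1, 12110903050710080406), (0, 12111009080706050403)]),
  ([31012, 50812, 60912, 20509, 109], 5121009110304060708, [(4, 8110612100907050304), (4,
    8110712100906050304), (4, 8110712100905040306), (4, 7110412081009060503), (4,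
    7110612081009040503), (4, 7110612100908050304), (4, 11100612080907040503), (4,
    11090612100807050304), (4, 6110412081009070503), (4, 11080912100706050304), (4,
    9110412081007060503), (4, 11100412080907060503), (4, 11100912080706040503), (4,
    11071012080604030509), (0, 12111009080706050403)]),
  ([31012, 50812, 60912, 20509], 5120611080907041003, [(5, 7110412081009060503), (5,
    10110912080604030507), (5, 10110912080706030504), (5, 10110712080906030504), (5,
    9110812100706050304), (5, 8110712100906050304), (5, 9110712100806050304), (5,
    11090812100605040307), (5, 11080912100605040307), (5, 9110812100605040307), (5,
    11070912100605040308), (5, 11090812100705040306), (5, 11090612100807040305), (1,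
    12111009080706050403), (0, 12111005060708090403)]),
  ([31012, 50812, 60912, 10206, 212, 103], 9121004060307110805, [(6, 11090712100806040305), (6,
    8110712091005040603), (6, 11100812090705040603), (6, 11090812100605040307), (6,
    11100612080907040503), (6, 11090712100805040306), (6, 11100712080906040503), (6,
    7110612100908050304), (6, 7110412081009060503), (6, 7110612081009040503), (6,
    6110412081009070503), (6, 10110612080907030504), (6, 10110912080706030504), (0,
    12110810060703090405)]),
  ([31012, 50812, 60912, 10206, 212], 5080911071003060412, [(7, 10110612080907030504), (7,
    6110412081009070503), (7, 10110712080904030506), (7, 7110612081009040503), (7,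
    11100712080906040503), (7, 11071012080604030509), (7, 10110912080604030507), (7,
    11091012080604030507), (7, 9110812100605040307), (7, 11090812100605040307), (7,
    11080912100605040307), (7, 11080912100706040305), (7, 11070912100605040308), (1,
    12111009080706050403), (1, 12111009050706080403), (0, 12110809100706030405)]),
  ([31012, 50812, 60912, 10206, 112, 205], 8120911050410030607, [(8, 10110712080904030506), (8,
    7110612081009040503), (8, 10110612080907030504), (8, 6110412081009070503), (8,
    5110412091008070603), (8, 11081012090704030605), (8, 11091012080706030504), (8,
    10110512090807030604), (8, 11080912100706050304), (8, 9110512100807060304), (8,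
    11090512100807060304), (8, 11080912100706040305), (8, 11070912100605040308), (2,
    12111009050706080403)]),
  ([31012, 50812, 60912, 10206, 112], 3100604070511090812, [(9, 11070912100605040308), (9,
    9110712100806040305), (9, 11080912100605040307), (9, 11080912100706040305), (9,
    11090712100806050304), (9, 11090512100807060304), (9, 11090712100806040305), (9,
    6110512100908070304), (9, 7110612100908040305), (9, 7110512100908060304), (9,
    10110712080904030506), (9, 10110712080906030504), (9, 7110612100908050304), (9,
    6110412081009070503), (9, 10110612080907030504), (0, 12110809100706030405)]),
  ([31012, 50812, 60912, 10206], 12081007030504110906, [(10, 11090612100807050304), (10,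
    9110512100807060304), (10, 11080912100706040305), (10, 11080912100706050304), (10,
    11100512090807040603), (10, 11100412080907060503), (10, 11090512100807060304), (10,
    7110412081009060503), (10, 7110512100908060304), (10, 5110412091008070603), (10,
    10110712090804030605), (10, 7110512091008040603), (10, 8110712091005040603), (10,
    10110812090504030607), (4, 12110910050703080406), (0, 12111009080706050403), (2,
    12111009080706050403)]),
  ([31012, 50812, 60912, 206, 105], 9050611121008070403, [(11, 8110712091005040603), (11,
    8110412091007050603), (11, 7110412081009060503), (11, 10110812090705030604), (11,
    10110712080906030504), (11, 8110712100906050304), (11, 10110812090504030607), (11,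
    11071012090504030608), (11, 11091012080704030506), (11, 11080912100706040305), (11,
    11090612100807040305), (5, 12111009080706050403), (0, 12111006080709050403)]),
  ([31012, 50812, 60912, 206], 8050311120910070406, [(12, 10110712080904030506), (12,
    10110612080907030504), (12, 7110612100908050304), (12, 10110912080706030504), (12,
    9110712100806050304), (12, 10110712080906030504), (12, 10110912080604030507), (12,
    11071012080604030509), (12, 11100912080706040503), (12, 11100812090705040603), (12,
    11100512090807040603), (6, 12110908100705030406), (6, 12110905100708030406), (1,
    12111008090705060403), (0, 12111009050706080403), (1, 12111005090708060403)]),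
  ([31012, 50812, 60912, 105], 6090804070310051112, [(13, 11100512090807040603), (13,
    11081012090704030605), (13, 7110512091008040603), (13, 10110712090804030605), (13,
    10110712080906030504), (13, 8110412091007050603), (13, 8110712091005040603), (13,
    7110412081009060503), (13, 9110812100605040307), (13, 9110712100806050304), (13,
    8110712100906050304), (13, 8110612100907050304), (13, 9110812100706050304), (7,
    12111008090705060403), (7, 12111009050706080403), (2, 12111006080709050403), (0,
    12111009080706050403), (2, 12111009080706050403)]),
  ([31012, 50812, 60912], 9060811071004030512, [(14, 10110512090807030604), (14,
    5110412091008070603), (14, 7110412081009060503), (14, 11090712100806050304), (14,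
    11091012080706030504), (14, 10110712080906030504), (14, 11071012090504030608), (14,
    10110812090504030607), (14, 11091012080604030507), (14, 8110712100905040306), (14,
    11090712100805040306), (14, 11090812100605040307), (14, 11070912100605040308), (14,
    11090812100705040306), (8, 12111009050706080403), (8, 12111008090705060403), (3,
    12111009080706050403), (0, 12111008060705090403), (1, 12111006080709050403), (3,
    12111006080709050403)]),
  ([31012, 50812, 20304, 10212, 10405], 4080509061211100703, [(15, 11100712080906040503), (0,
    12091108100605030407), (15, 11091012080604030507), (15, 11091012080704030506), (15,
    11080912100705040306), (0, 12071108100605030409), (0, 12091108100705030406), (0,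
    12110908100705030406), (15, 9110812100705040306), (15, 9110612100807040305), (15,
    9110812100706050304)]),
  ([31012, 50812, 20304, 104, 20910], 10040712031106090508, [(16, 9110812100705040306), (16,
    11090612100807040305), (16, 11080912100706040305), (16, 9110612100807040305), (16,
    11100912080706040503), (16, 9110612081007040503), (16, 11080912100705040306), (1,
    12091108100705030406), (16, 11100612080907040503), (1, 12091108100605030407), (16,
    11100712080906040503), (1, 12110708100905030604), (16, 10110712080906030504)]),
  ([31012, 50812, 20304, 10212, 104], 3100706090508041112, [(2, 12091108100705030604), (17,
    11090512100807060304), (17, 11090812100706050304), (17, 9110512100807060304), (17,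
    9110812100706050304), (17, 9110812100705040306), (17, 7110612100908040305), (17,
    9110712100806040305), (17, 9110612100807040305), (17, 10110912080604030507), (17,
    10110912080704030506), (17, 9110712100805040306), (17, 7110612081009040503), (17,
    10110712080904030506), (0, 12111007080906050403)]),
  ([31012, 50812, 20304, 10212], 4050811071203090610, [(18, 10110912080704030506), (3,
    12110908100705030406), (18, 9110612081007040503), (3, 12110908100605030407), (18,
    9110712081006040503), (18, 11100712080906040503), (3, 12091108100605030407), (18,
    11090712100806040305), (18, 11090812100605040307), (18, 11090512100807060304), (18,
    11090812100706050304), (2, 12111009080706050403), (0, 12111009080706050403)]),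
  ([31012, 50812, 20304, 103, 212, 10205], 10030504080611090712, [(4, 12071108100605030409), (4,
    12091108100605030407), (4, 12110908100605030407), (19, 11090712100805040306), (19,
    9110712100805040306), (19, 11080912100605040307), (19, 9110812100705040306), (19,
    11070912100605040308), (19, 11080912100705040306), (19, 11090812100706050304), (19,
    11090612100807050304), (19, 11090812100705040306), (19, 6110512100908070304), (19,
    8110612100907050304), (0, 5111009120706080304)]),
  ([31012, 50812, 20304, 103, 212], 8031204110509070610, [(20, 10110912080604030507), (20,
    10110912080704030506), (20, 10110712080904030506), (20, 9110612100807040305), (20,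
    7110612100908040305), (20, 9110712100805040306), (20, 11090712100806040305), (20,
    11080912100605040307), (20, 9110712100806040305), (20, 11080912100706050304), (20,
    9110512100807060304), (20, 11080912100706040305), (20, 11090512100807060304), (5,
    12091108100705030604), (0, 12111009050706080403)]),
  ([31012, 50812, 20304, 103], 12030504080911071006, [(21, 11090712100805040306), (21,
    11091012080704030506), (21, 10110712080904030506), (21, 11071012080604030509), (21,
    10110912080604030507), (21, 11091012080604030507), (21, 9110812100605040307), (21,
    11090812100605040307), (21, 11080912100605040307), (21, 11090812100706050304), (21,
    11080912100706050304), (21, 11070912100605040308), (21, 9110512100807060304), (21,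
    9110812100706050304), (0, 12111009080706050403), (2, 12111009080706050403)]),
  ([31012, 50812, 20304], 3120504070809110610, [(22, 11071012080604030509), (22,
    10110912080704030506), (22, 11091012080704030506), (22, 9110812100705040306), (22,
    11090812100705040306), (22, 11080912100705040306), (22, 11090812100605040307), (22,
    11080912100605040307), (22, 11070912100605040308), (22, 9110712100806050304), (22,
    9110812100706050304), (22, 9110812100605040307), (22, 8110712100906050304), (7,
    12110708100905030604), (22, 7110512100908060304), (3, 12111009080706050403), (0,
    12111009080706050403)]),
  ([31012, 50812, 10203, 208, 105], 7050809061211100403, [(23, 11100412080907060503), (8,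
    12091108100705030604), (23, 11091012080706030504), (23, 11091012080704030506), (23,
    11080912100705040306), (8, 12071108100605030409), (8, 12091108100705030406), (8,
    12110908100705030406), (23, 9110612100807040305), (23, 9110812100705040306), (23,
    9110712100806040305), (23, 9110812100605040307), (0, 12110809100604030705)]),
  ([31012, 50812, 10203, 208], 5080411091210070603, [(24, 7110612081009040503), (9,
    12110708100905030406), (24, 10110712080904030506), (9, 12110908100605030407), (24,
    10110912080604030507), (24, 11071012080604030509), (9, 12091108100705030604), (9,
    12110908100705030604), (9, 12071108100605030409), (24, 9110812100706050304), (24,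
    11070912100605040308), (24, 11080912100706050304), (24, 11090512100807060304), (24,
    11090812100706050304), (1, 12110809100706030405), (0, 12111009080706050403)]),
  ([31012, 50812, 10203, 105], 8050411071210090603, [(25, 9110612081007040503), (10,
    12110908100705030406), (25, 10110912080704030506), (10, 12110908100605030407), (25,
    10110912080604030507), (25, 11091012080604030507), (10, 12091108100705030604), (10,
    12110708100905030604), (10, 12091108100605030407), (25, 7110512100908060304), (25,
    11090712100806040305), (25, 11090712100806050304), (25, 11090812100706050304), (25,
    11090512100807060304), (2, 12110509100706030408), (2, 12110809100706030405), (0,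
    12111009080706050403)]),
  ([31012, 50812, 10203], 8050411061003070912, [(11, 12110908100605030407), (26,
    10110912080604030507), (26, 9110712081006040503), (26, 10110712080904030506), (26,
    7110612081009040503), (26, 11100612080907040503), (26, 11091012080706030504), (26,
    10110612080907030504), (26, 11091012080704030506), (26, 6110512100908070304), (26,
    11090612100807040305), (26, 11090612100807050304), (26, 11090812100706050304), (26,
    11090512100807060304), (3, 12110509100706030408), (3, 12110809100706030405), (0,
    12111009050706080403), (1, 12111009080706050403)]),
  ([31012, 50812, 205, 108], 3100407060509121108, [(27, 11070912100605040308), (27,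
    11080912100706040305), (12, 12071108100605030409), (12, 12110908100705030406), (27,
    9110712100805040306), (27, 9110712100806040305), (27, 9110612100807040305), (27,
    7110512100908060304), (27, 6110512100908070304), (27, 7110612100908040305), (27,
    10110612080907030504), (27, 10110712080904030506), (27, 7110612100908050304), (27,
    7110412081009060503), (27, 10110712080906030504), (4, 12111009080706050403), (4,
    12110309080706050410), (0, 12110309080706050410), (0, 12111009080706050403)]),
  ([31012, 50812, 205], 8050904111003070612, [(13, 12110708100905030406), (28,
    10110712080904030506), (28, 7110612081009040503), (28, 11091012080604030507), (28,
    11100712080906040503), (28, 11100412080907060503), (28, 10110912080706030504), (28,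
    11071012080604030509), (28, 11091012080706030504), (28, 11080912100706040305), (28,
    11090512100807060304), (28, 11080912100706050304), (28, 9110812100706050304), (28,
    9110512100807060304), (5, 12110507100604030908), (0, 12111009080706050403), (1,
    12110509100706030408)]),
  ([31012, 50812, 110], 3100604071211090508, [(29, 11070912100605040308), (29,
    11080912100706040305), (14, 12110908100605030407), (29, 11080912100605040307), (14,
    12071108100605030409), (29, 11090712100806050304), (14, 12091108100705030604), (14,
    12091108100605030407), (14, 12110608100905030704), (14, 12110708100905030406), (14,
    12110708100905030604), (29, 10110712080904030506), (29, 10110712080906030504), (29,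
    7110612100908050304), (29, 6110412081009070503), (29, 10110612080907030504), (6,
    12111009080704050603), (6, 12110309080704050610), (0, 12110809100706030405), (2,
    12111009080706050403)]),
  ([31012, 50812], 5080907041012110603, [(30, 11100612080907040503), (30, 11091012080704030506),
    (15, 12091108100705030406), (30, 11091012080706030504), (15, 12091108100705030604), (15,
    12110708100905030604), (30, 10110912080604030507), (30, 10110912080706030504), (30,
    10110712080906030504), (30, 9110812100706050304), (30, 8110712100906050304), (30,
    9110712100806050304), (30, 9110712100806040305), (30, 9110812100605040307), (7,
    12110807100604030905), (7, 12110507100604030908), (3, 12110509100706030408), (0,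
    12110509100706030408), (1, 12111009080706050403), (3, 12110809100706030405)]),
  ([31012, 20612, 10610, 10203], 6040310050709081211, [(31, 11070912100605040308), (0,
    12081107100605030409), (0, 12091107100605030408), (0, 12110908100605030407), (0,
    12110809100605030407), (0, 12110907100605030408), (31, 8110712100906040305), (31,
    9110812100706040305), (31, 9110812100605040307), (0, 10110908120706030405), (0,
    10110908120605030407), (31, 9110712100806040305), (0, 3110709120806100405), (0,
    10110709120806030405), (0, 3110509120807100604), (0, 10110509120807030604), (0,
    3110609120807100504)]),
  ([31012, 20612, 10610], 6031007050908110412, [(1, 12091107100605030408), (1,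
    12110809100706030504), (1, 12091108100706030504), (32, 9110812100706050304), (32,
    11080912100706050304), (32, 11090812100706050304), (32, 11080912100706040305), (32,
    11090812100706040305), (32, 11070912100605040308), (32, 8110712100906040305), (32,
    9110812100605040307), (32, 9110812100706040305), (1, 10110908120605030407), (1,
    10110908120706030405), (32, 9110712100806040305), (1, 3110709120806100405), (1,
    10110709120806030405), (1, 3110709120805100406), (0, 12111009080706050403)]),
  ([31012, 20612, 106, 20410], 12100906031105080704, [(33, 8110512100907060304), (33,
    7110512100908060304), (33, 8110712100906050304), (33, 11090712100806040305), (33,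
    11090812100605040307), (33, 8110712100906040305), (2, 3091107120605100408), (2,
    3110809120706100405), (33, 11090812100706040305), (2, 3110609120807100405), (33,
    11090612100807040305), (2, 3091108120706100405), (33, 11080912100705040306), (2,
    3081107120605100409), (2, 3091108120705100406), (2, 3110908120705100406), (2,
    10110908120705030406)]),
  ([31012, 20612, 10203, 106], 12100908030406070511, [(34, 11090712100805040306), (34,
    11090612100807040305), (34, 11090712100806040305), (34, 6110512100908070304), (34,
    7110512100908060304), (34, 7110612100908040305), (3, 3110709120806100504), (3,
    3110709120805100406), (34, 7110612100908050304), (3, 3110809120705100406), (34,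
    8110612100907050304), (3, 3110609120807100504), (34, 9110812100706050304), (3,
    3110908120706100504), (3, 3110809120706100504), (3, 3110907120605100408), (3,
    12110907100605030408), (3, 10110907120605030408), (0, 12111008070506040903)]),
  ([31012, 20612, 10203], 6100304050812090711, [(4, 12081107100605030409), (4,
    12091108100605030407), (35, 11080912100605040307), (4, 12110809100605030407), (35,
    9110812100605040307), (4, 12110908100605030407), (35, 9110812100706040305), (4,
    12110908100706030405), (4, 12110907100605030408), (4, 12110509100807030604), (4,
    12110809100706030504), (4, 12110809100706030405), (4, 3110809120706100504), (4,
    3110809120706100405), (35, 8110512100907060304), (4, 10110509120807030604), (4,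
    3110509120807100604), (4, 10110609120807030504), (4, 3110609120807100504), (2,
    12111009080706050403), (0, 12111009080706050403)]),
  ([31012, 20612, 106], 12100907050403110608, [(5, 3091107120605100408), (5, 3110809120705100406),
    (36, 11090812100705040306), (5, 3110609120807100504), (36, 11090612100807050304), (5,
    3091108120705100406), (36, 11090512100807060304), (5, 3091108120706100405), (5,
    3091108120706100504), (5, 3110709120806100405), (5, 3110709120806100504), (5,
    3110509120807100604), (36, 9110712100806050304), (36, 9110512100807060304), (36,
    7110512100908060304), (5, 10110908120706030405), (5, 10110709120806030405), (36,
    9110712100806040305), (5, 12110908100605030407), (5, 10110908120605030407), (2,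
    12111008070506040903), (0, 12110309080706050410)]),
  ([31012, 20612], 6031011051208090407, [(37, 9110812100605040307), (37, 8110712100906050304),
    (37, 9110712100806050304), (6, 12110809100706030504), (6, 12110908100706030504), (37,
    9110812100706050304), (6, 12110908100706030405), (37, 9110812100706040305), (6,
    12110907100605030408), (37, 11090812100706040305), (6, 12091107100605030408), (6,
    12110809100706030405), (6, 12091108100706030405), (6, 3091108120706100405), (6,
    10091108120706030405), (6, 3091108120705100406), (6, 10091108120705030406), (1,
    12111009080706050403), (4, 12110309080706050410), (0, 12111009080706050403)]),
  ([31012, 10203, 210, 112], 9120304110506071008, [(38, 8110712100905040306), (7,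
    10110809120705030406), (7, 10110809120605030407), (7, 10110609120807030405), (7,
    10110709120806030405), (7, 10110709120805030406), (38, 11090712100806040305), (38,
    11090712100805040306), (38, 7110612100908040305), (38, 11090612100807050304), (38,
    6110512100908070304), (38, 11090612100807040305), (7, 3110509120807100604), (7,
    3091108120706100405), (38, 11090512100807060304), (7, 12091108100706030504), (7,
    3091108120706100504), (7, 12110908100706030504), (7, 3110908120706100504), (0,
    12111008070609050403)]),
  ([31012, 10203, 210], 12100506110704080309, [(39, 9110812100706050304), (8,
    3110908120706100504), (8, 3110907120605100408), (8, 3110709120806100504), (8,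
    3110809120605100407), (8, 3110809120706100504), (39, 11090812100605040307), (39,
    11090812100706050304), (39, 8110712100906050304), (39, 11090612100807050304), (39,
    7110612100908050304), (39, 11090712100806050304), (39, 7110612100908040305), (39,
    11090712100806040305), (39, 11090712100805040306), (8, 10091108120706030405), (8,
    10091108120705030406), (39, 11090612100807040305), (8, 12110609100807030405), (8,
    10110609120807030405), (1, 12111009080705060403), (0, 12111009080706050403)]),
  ([31012, 10203, 110], 12100704090311080506, [(40, 11090812100705040306), (40,
    11090612100807040305), (40, 8110612100907040305), (9, 3091108120706100405), (9,
    3110809120706100405), (40, 11090812100706040305), (9, 3110907120605100408), (40,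
    11070912100605040308), (9, 3091107120605100408), (40, 11080912100706050304), (9,
    3091108120706100504), (9, 3081107120605100409), (9, 3110709120806100504), (9,
    3110908120605100407), (9, 3110908120706100504), (9, 10110908120605030407), (9,
    10110908120706030504), (40, 9110712100806050304), (9, 12110709100806030504), (9,
    10110709120806030504), (2, 12111009080607050403), (2, 10111209080607050403), (0,
    10111209080706050403)]),
  ([31012, 10203], 10120508070609030411, [(10, 3081107120605100409), (41, 11080912100706050304),
    (10, 3091108120706100504), (41, 9110612100807050304), (10, 3110609120807100504), (10,
    3110908120706100504), (10, 3110709120805100406), (10, 3110908120605100407), (10,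
    3110908120705100406), (41, 9110812100605040307), (41, 9110812100705040306), (41,
    9110712100805040306), (41, 8110612100907040305), (41, 7110612100908040305), (41,
    8110712100905040306), (10, 12110709100806030405), (10, 12110809100605030407), (41,
    8110712100906040305), (10, 10110809120706030405), (10, 12110809100706030405), (3,
    10111209080705060403), (3, 12111009080705060403), (0, 12111009080706050403), (1,
    12111009080706050403)]),
  ([31012, 210, 112], 3100607120809041105, [(42, 9110512100807060304), (42, 11080912100706040305),
    (42, 11090512100807060304), (42, 11070912100605040308), (42, 11090812100706050304), (42,
    11080912100706050304), (11, 12110809100706030504), (11, 12110908100706030504), (42,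
    9110812100706050304), (11, 12110908100605030407), (42, 9110812100605040307), (11,
    12110907100605030408), (42, 8110712100905040306), (11, 12110809100705030406), (11,
    12110809100605030407), (11, 12110709100805030406), (11, 3110709120805100406), (11,
    10110709120805030406), (4, 3111209080706050410), (0, 12111009080706050403)]),
  ([31012, 210], 3100607120905110408, [(43, 11090812100706040305), (43, 8110512100907060304), (43,
    11090812100706050304), (43, 9110512100807060304), (43, 11080912100706050304), (43,
    11090512100807060304), (12, 12081107100605030409), (12, 12091108100706030405), (43,
    11080912100706040305), (12, 12110709100806030405), (43, 9110712100806040305), (12,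
    12110908100706030405), (43, 9110712100805040306), (12, 12110908100705030406), (12,
    12110908100605030407), (12, 12110709100805030406), (12, 3110709120805100406), (12,
    10110709120805030406), (5, 3111209080706050410), (0, 3111009080706050412), (1,
    12111009080706050403)]),
  ([31012, 103], 10120411030508090706, [(44, 9110812100705040306), (44, 8110712100905040306), (44,
    9110712100805040306), (44, 8110712100906040305), (44, 9110712100806040305), (44,
    9110812100605040307), (13, 3110908120706100405), (13, 3110907120605100408), (44,
    9110812100706040305), (13, 3091107120605100408), (44, 11090812100706040305), (13,
    3110809120706100405), (44, 11090512100807060304), (13, 3110509120807100604), (13,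
    3091108120706100405), (13, 3091108120706100504), (13, 10091108120706030504), (13,
    12091108100706030504), (6, 10111209080704060503), (6, 12111009080704060503), (2,
    10110309080706050412), (0, 12111009080706050403), (2, 12110309080706050410)]),
  ([31012], 12030804061107100905, [(14, 10110709120806030405), (45, 9110712100806040305), (14,
    10110908120706030405), (45, 11080912100605040307), (14, 10081107120605030409), (14,
    10110908120605030407), (14, 10091108120705030406), (14, 10110709120805030406), (14,
    10091108120605030407), (45, 7110612100908050304), (45, 11090712100806050304), (45,
    11090712100805040306), (45, 11090812100706050304), (45, 11090812100705040306), (45,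
    11090612100807050304), (14, 3110809120705100406), (14, 3110609120807100504), (45,
    8110612100907050304), (14, 12110809100706030504), (14, 3110809120706100504), (7,
    12111009070608050403), (7, 3111209070608050410), (3, 12111009080706050403), (0,
    10110309080706050412), (1, 10111209080706050403), (3, 10110309080706050412)]),
  ([20508, 20607, 10608], 6051009080407110312, [(0, 12101109080605040307), (0,
    12110710090806050403), (0, 12101109080706050403), (0, 7120411100908060503), (0,
    11120410090807060503), (0, 11120710090806050403), (0, 11120810090706050304), (0,
    11120810090605040307), (0, 11120710090806050304), (0, 9120811100605040307), (0,
    9120711100806050304), (0, 8120711100906050304), (0, 10120911080706050304), (0,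
    10120811090706050304), (0, 9120811100706050304), (0, 10120911070605040308), (0,
    9120611100807040305), (0, 10120911080705040306), (0, 10120911080706040305), (0,
    10120611090807040305)]),
  ([20508, 20607, 106], 5071209080403101106, [(1, 10120611090807050403), (1,
    11120610090807050403), (1, 11121009080705040306), (1, 11120410090807060503), (1,
    11121009080706050304), (1, 11121009080706050403), (1, 10120811090706050304), (1,
    10120811090706050403), (1, 10120411090807060503), (1, 9120811100706050403), (1,
    9120411100807060503), (1, 8120411100907060503), (1, 12110910080706050304), (1,
    12110810090706050304), (1, 9120811100706050304), (1, 12110810090605040307), (1,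
    9120811100605040307), (1, 12110910070605040308), (1, 9120711100806040305), (1,
    12110910080706040305), (1, 12110910080605040307), (1, 12110710090806040305), (0,
    12111009070805060403)]),
  ([20508, 20607], 6050912030410110708, [(2, 11121009070605040308), (2, 10120811090605040307), (2,
    11120810090605040307), (2, 10120711090806050304), (2, 11120710090806050304), (2,
    11121009080605040307), (2, 11120410090807060503), (2, 11121009080706050403), (2,
    11121009080706050304), (2, 12111009080706050403), (2, 12111009080706050304), (2,
    10120411090807060503), (2, 12110910080706050304), (2, 9120411100807060503), (2,
    12110410090807060503), (2, 9120511100807060403), (2, 12110510090807060403), (2,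
    12110910080706050403), (2, 12110610090807040305), (2, 12110910080705040306), (2,
    12110910080706040305), (2, 9120611100807040305), (1, 12111009060805070403), (0,
    12111009080706050403)]),
  ([20508, 10408, 10206], 8110403120710060905, [(3, 10120611090807040305), (3,
    10120911080706040305), (3, 9120611100807040305), (3, 10120911080605040307), (3,
    9120711100805040306), (3, 10120911080705040306), (3, 12110710090805040306), (3,
    12111009080705040306), (3, 10120711090805040306), (3, 12111009080706050403), (3,
    10120711090806050403), (3, 12111009080605040307), (3, 7120411100908060503), (3,
    12110710090806050304), (3, 12110710090806050403), (3, 12101109080706050304), (3,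
    12101109080706050403), (3, 12110410090807060503), (3, 11120810090706050403), (3,
    11120410090807060503), (0, 12100907110805040603)]),
  ([20508, 10408], 8060409100712030511, [(4, 12101109080706050403), (4, 12101109080706040305), (4,
    11120510090807060403), (4, 12110710090806040305), (4, 7120511100908060403), (4,
    12110510090807060403), (4, 10120711090806050403), (4, 12111009080706050403), (4,
    12110710090806050403), (4, 12111008070605040309), (4, 12110910080605040307), (4,
    12111009080605040307), (4, 9120711100806050304), (4, 10120711090806050304), (4,
    10120911080605040307), (4, 10120611090807050304), (4, 10120911080705040306), (4,
    10120911080706050304), (4, 9120811100705040306), (4, 9120611100807050304), (1,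
    12111009060805040703), (0, 12111009080706050403)]),
  ([20508, 10203, 105], 8090611050412070310, [(5, 12111009080605040307), (5,
    12111009080706050403), (5, 10120711090806050403), (5, 12110410090807060503), (5,
    7120411100908060503), (5, 12110710090806050403), (5, 7120511100908060304), (5,
    12110710090806040305), (5, 12110710090806050304), (5, 12101109080706040305), (5,
    12101109080706050304), (5, 12110510090807060304), (5, 11120610090807050304), (5,
    6120511100908070304), (5, 11120510090807060304), (5, 9120611100807040305), (5,
    11120910080706040305), (5, 11120610090807040305), (5, 11120910070605040308), (5,
    11120810090705040306), (5, 11120910080705040306), (2, 12111007090805060403), (5,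
    9120811100705040306), (0, 12111007080604050903)]),
  ([20508, 10203], 5110709121008030604, [(6, 8120411100907060503), (6, 8120611100907050304), (6,
    6120411100908070503), (6, 10120811090705040306), (6, 10120611090807050403), (6,
    8120611100907050403), (6, 12111009080706050403), (6, 12110810090706050403), (6,
    10120811090706050403), (6, 12110910070605040308), (6, 10120911070605040308), (6,
    12111009070605040308), (6, 10120911080605040307), (6, 12111009080605040307), (6,
    12111008070605040309), (6, 12101109080605040307), (6, 12101108070605040309), (6,
    12110910080605040307), (6, 11120910080706040305), (6, 9120711100806040305), (6,
    11120910080605040307), (3, 12100906110805070403), (6, 11120710090806040305), (1,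
    12100907050604081103), (0, 12111009080706050403)]),
  ([20508, 108], 5060411091203071008, [(7, 8120711100906050403), (7, 10120811090706050403), (7,
    10120811090605040307), (7, 12111009080706050403), (7, 12111009080605040307), (7,
    10120711090806050403), (7, 12110910080605040307), (7, 9120711100806050403), (7,
    12110710090806050403), (7, 11120910080706050403), (7, 12101109080706050403), (7,
    12110910080706050403), (7, 12101109080706050304), (7, 12110910080706050304), (7,
    12101108070605040309), (7, 9120611100807050304), (7, 11120910080705040306), (7,
    11120910080706050304), (7, 11120610090807040305), (7, 11120510090807060304), (7,
    11120610090807050304), (4, 12111009060805040703), (7, 6120511100908070304), (0,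
    12111009080704050306), (2, 12111009050704080603)]),
  ([20508], 5090611041208100703, [(8, 10120811090706050403), (8, 8120711100906050403), (8,
    10120711090806050403), (8, 12110810090605040307), (8, 12111009080605040307), (8,
    10120811090605040307), (8, 12111009080706050304), (8, 10120811090706050304), (8,
    12111009070605040308), (8, 11120810090706050304), (8, 12101109070605040308), (8,
    12110810090706050304), (8, 12101109080705040306), (8, 12110610090807050304), (8,
    12101109080706050304), (8, 9120611100807050304), (8, 11120910080706050304), (8,
    11120610090807050304), (8, 11120910080706040305), (8, 11120610090807040305), (8,
    11120910080705040306), (5, 12111007090805060403), (8, 9120611100807040305), (1,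
    12111007080604050309), (3, 12111007050604080903), (0, 12111009050706080403)]),
  ([10406, 10208, 206], 4030705100608111209, [(9, 11120910070605040308), (9,
    12110910070605040308), (9, 12101108070605040309), (9, 12110810090705040306), (9,
    12101109080705040306), (9, 12101109070605040308), (9, 11121009080705040306), (9,
    11121009070605040308), (9, 11120810090705040306), (9, 10120811090706040305), (9,
    8120611100907040305), (9, 10120811090705040306), (9, 7120611100908040305), (9,
    10120711090805040306), (9, 10120611090807040305), (9, 10120711090806050403), (9,
    10120511090807060403), (9, 10120711090806040305), (9, 5120411100908070603), (9,
    7120511100908060304), (9, 7120511100908060403), (0, 12111009070806040503), (0,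
    12111009070806030504), (9, 7120411100908060503), (0, 12111009040807030605)]),
  ([10406, 10208], 4030908101107051206, [(10, 7120611100908040305), (10, 12110710090805040306),
    (10, 12110610090807040305), (10, 12101109080605040307), (10, 12101109080706040305), (10,
    12110710090806040305), (10, 11121009080706040305), (10, 10120711090806040305), (10,
    11120710090806040305), (10, 10120811090605040307), (10, 11120810090605040307), (10,
    11121009080605040307), (10, 11120910070605040308), (10, 11121008070605040309), (10,
    11121009070605040308), (10, 10120911080706050403), (10, 10120811090706050403), (10,
    10120911070605040308), (10, 8120411100907060503), (10, 9120811100706050304), (10,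
    9120811100706050403), (1, 12111008090706040503), (1, 12111008090706030504), (10,
    9120411100807060503), (1, 12111009040807030605), (0, 12111009080704050603)]),
  ([10406, 204], 6111204100903070508, [(11, 8120711100906050403), (11, 8120511100907060403), (11,
    8120711100906040305), (11, 9120511100807060403), (11, 9120711100806040305), (11,
    7120511100908060403), (11, 10120911080605040307), (11, 10120711090806050403), (11,
    9120711100806050403), (11, 10120411090807060503), (11, 9120411100807060503), (11,
    10120911080706050403), (11, 12110910080706050304), (11, 12111008070605040309), (11,
    10120911080706050304), (11, 12091108070605040310), (11, 11121009080706050304), (11,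
    12111009080706050304), (11, 12101109080706050304), (2, 11100908120705060403), (2,
    10090807120605110403), (11, 12101109080705040306), (0, 12100908110706050403), (2,
    12100908110705060403)]),
  ([10406], 6081105040903121007, [(12, 12110710090806050403), (12, 10120711090806050403), (12,
    12111009080605040307), (12, 10120911080706050403), (12, 12111008070605040309), (12,
    12111009080706050403), (12, 12110910080706050304), (12, 12110410090807060503), (12,
    12110910080706050403), (12, 5120411100908070603), (12, 9120511100807060403), (12,
    9120411100807060503), (12, 11120910080706040305), (12, 11120910080706050304), (12,
    9120511100807060304), (12, 11120810090706050304), (12, 8120511100907060304), (12,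
    11120510090807060304), (12, 8120611100907040305), (12, 11120610090807040305), (12,
    11120810090706040305), (3, 12100908110705060403), (3, 12100907110605080403), (12,
    11120810090705040306), (1, 12111009080706050403), (3, 12111009080705060403), (0,
    12111009080704050603)]),
  ([10210, 203, 106], 4051109080603071210, [(13, 10120711090806050403), (13,
    12111009080706050403), (13, 12111009080605040307), (13, 12110610090807050403), (13,
    12110710090805040306), (13, 12110710090806050403), (13, 8120711100905040306), (13,
    8120711100906050403), (13, 7120611100908050403), (13, 9120811100706050403), (13,
    9120611100807050403), (13, 8120611100907050403), (13, 11120910080705040306), (13,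
    11120810090705040306), (13, 9120811100705040306), (13, 11120810090706040305), (13,
    9120811100706040305), (13, 11120910070605040308), (13, 9120511100807060304), (13,
    11120910080706050304), (13, 11120910080706040305), (4, 12100908110706040503), (4,
    12100908110706050403), (13, 11120510090807060304), (0, 12111009080705060403), (4,
    12111009050807040603)]),
  ([10210, 203], 6090510070803041211, [(14, 11120410090807060503), (14, 12101109080706050403),
    (14, 12101109080706050304), (14, 12110810090706050403), (14, 12110810090706050304), (14,
    12110410090807060503), (14, 8120711100906050304), (14, 7120411100908060503), (14,
    8120411100907060503), (14, 10120711090806050403), (14, 10120811090706050403), (14,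
    8120711100906050403), (14, 10120811090706040305), (14, 8120711100906040305), (14,
    10120811090605040307), (14, 9120711100806040305), (14, 10120911080605040307), (14,
    10120711090806040305), (14, 10120911080705040306), (14, 10120611090807040305), (14,
    10120911080706040305), (5, 12111009060807050403), (5, 12111008090706050403), (14,
    9120611100807040305), (1, 12111008070509040603), (5, 12111008090705060403), (0,
    12111009080706050403)]),
  ([10210, 112], 6051012070304080911, [(15, 11120810090706050304), (15, 11120910080706050304),
    (15, 11120910070605040308), (15, 9120411100807060503), (15, 9120811100706050403), (15,
    9120811100706050304), (15, 8120711100906050403), (15, 8120711100906050304), (15,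
    8120411100907060503), (15, 12110710090806050304), (15, 12110410090807060503), (15,
    7120411100908060503), (15, 12111009080706050403), (15, 10120711090806050403), (15,
    12110710090806050403), (15, 10120711090806040305), (15, 12110710090806040305), (15,
    12111009080605040307), (15, 12110610090807040305), (15, 12111009080705040306), (15,
    12111009080706040305), (15, 10120611090807040305), (2, 12111009080706040503), (6,
    12111009060807050403), (0, 12111009080705040306)]),
  ([10210], 8041103091205071006, [(16, 7120611100908040305), (16, 10120611090807040305), (16,
    10120711090805040306), (16, 12111009080706040305), (16, 12111009080605040307), (16,
    10120711090806040305), (16, 12110910080605040307), (16, 9120711100806040305), (16,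
    12110710090806040305), (16, 9120511100807060403), (16, 12110510090807060403), (16,
    12110910080706040305), (16, 12101109080706050403), (16, 12101108070605040309), (16,
    12110910080706050403), (16, 11120910080706050304), (16, 9120411100807060503), (16,
    11120910080706050403), (16, 8120411100907060503), (16, 11120810090706050403), (16,
    11120410090807060503), (7, 12100907110605080403), (7, 12100908110706040503), (16,
    11120810090706050304), (3, 12111009070608050403), (7, 12111009080706040503), (0,
    8121011090706050403), (1, 12111009070605040308)]),
  ([204, 107], 12030710110904080605, [(17, 8120511100907060304), (17, 6120511100908070304), (17,
    8120611100907040305), (17, 9120611100807050304), (17, 9120811100705040306), (17,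
    8120611100907050304), (17, 11120910070605040308), (17, 11120810090706050304), (17,
    9120811100706050304), (17, 11121009080706050304), (17, 10120911080706050304), (17,
    11120910080706050304), (17, 10120911080605040307), (17, 11120910080605040307), (17,
    11121008070605040309), (17, 11120710090806050403), (17, 11121009080706050403), (17,
    11121009080605040307), (17, 12111009080706050403), (17, 12111009080605040307), (17,
    10120711090806050403), (8, 11100908120605070403), (8, 12111009070806030504), (17,
    12110710090806050403), (0, 12110310090807060504), (4, 11100908070612050304), (8,
    11100908120706030504), (0, 11101209080706050403)]),
  ([204], 8110904070612031005, [(18, 12110510090807060403), (18, 12111009080706040305), (18,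
    10120511090807060403), (18, 12111009080705040306), (18, 10120611090807050403), (18,
    12111009080706050403), (18, 7120611100908050403), (18, 12110710090806050403), (18,
    12110610090807050403), (18, 12110710090806050304), (18, 12110610090807050304), (18,
    12110710090805040306), (18, 9120611100807050304), (18, 9120711100805040306), (18,
    7120611100908050304), (18, 11120910080605040307), (18, 11120710090806050304), (18,
    9120711100806050304), (18, 11120810090706050304), (18, 9120811100706050304), (18,
    11120910080706050304), (9, 12111007090605080403), (9, 12100807110605090403), (18,
    11120910070605040308), (1, 12101109080706050403), (5, 12100907060511040803), (9,
    12100907110605080403), (0, 12111009070806050403), (1, 12110810090706050403)]),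
  ([106], 3081004091105061207, [(19, 7120611100908040305), (19, 12110710090806040305), (19,
    12110710090805040306), (19, 12101109080706040305), (19, 12101109080705040306), (19,
    12110610090807040305), (19, 11120910080705040306), (19, 9120611100807040305), (19,
    11120610090807040305), (19, 9120511100807060304), (19, 11120510090807060304), (19,
    11120910080706040305), (19, 11121009080706050304), (19, 11121008070605040309), (19,
    11120910080706050304), (19, 10120911070605040308), (19, 9120811100706050304), (19,
    10120911080706050304), (19, 8120411100907060503), (19, 10120411090807060503), (19,
    10120811090706050304), (10, 12110908100706030504), (10, 12110907100605080403), (19,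
    10120811090706050403), (2, 12110810090706050403), (6, 12111009070608050304), (10,
    12111009080706030504), (0, 12111009080706050304), (2, 12110310090807060504)]),
  ([], 3060511080710041209, [(20, 10120911080706050304), (20, 12111008070605040309), (20,
    12110910080706050304), (20, 12111009080605040307), (20, 12110710090806050304), (20,
    12111009080706050304), (20, 8120711100906050304), (20, 10120811090706050304), (20,
    10120711090806050304), (20, 11121009070605040308), (20, 11121009080605040307), (20,
    10120811090605040307), (20, 11120710090806040305), (20, 8120711100906040305), (20,
    11120810090605040307), (20, 8120611100907040305), (20, 11120810090705040306), (20,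
    11120810090706040305), (20, 11120610090807050403), (20, 11120510090807060403), (20,
    11120610090807040305), (11, 12111009050807030604), (11, 12111009060807050403), (20,
    6120511100908070403), (3, 12110610090807050403), (7, 12111009080706050304), (11,
    12111009060807030504), (0, 12111009080703060504), (1, 12111009080706050304), (3,
    12110310090807060504)])]

theorem testBit_labelMask (l : List ℕ) (x : ℕ) : (labelMask l).testBit x = true ↔ x ∈ l := by
  induction l with
  | nil => simp [labelMask]
  | cons d l ih =>
    have : labelMask (d :: l) = 2 ^ d ||| labelMask l := rfl
    rw [this, Nat.testBit_or, Bool.or_eq_true, ih, Nat.testBit_two_pow]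
    simp [eq_comm]

theorem lt_of_mem_of_labelMask_le {l : List ℕ} (h : labelMask l ≤ 2 ^ 13 - 1) {x : ℕ}
    (hx : x ∈ l) : x < 13 := by
  by_contra hlt
  rw [← testBit_labelMask] at hx
  have : labelMask l < 2 ^ x :=
    lt_of_lt_of_le (by omega : labelMask l < 2 ^ 13) (Nat.pow_le_pow_right (by norm_num) (by omega))
  rw [Nat.testBit_lt_two_pow this] at hx
  exact Bool.noConfusion hx

theorem length_labelDigits (k n : ℕ) : (labelDigits k n).length = k := by
  induction k generalizing n with
  | zero => rfl
  | succ k ih => simp [labelDigits, ih]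

theorem labelDigits_eq_map_relabel (k s : ℕ) :
    labelDigits k s = (List.range' 3 k).map (relabel s) := by
  suffices h : labelDigits k s = (List.range k).map fun i => s / 100 ^ i % 100 by
    rw [h, List.range'_eq_map_range, List.map_map]
    refine List.map_congr_left fun i _ => ?_
    simp [relabel]
  induction k generalizing s with
  | zero => rfl
  | succ k ih =>
    rw [labelDigits, ih, List.range_succ_eq_map, List.map_cons, List.map_map]
    congr 1
    · simp
    · refine List.map_congr_left fun i _ => ?_
      simp [Nat.div_div_eq_div_mul, pow_succ, mul_comm]

/-- A list of the right length whose bit set is that of `r` is a permutation of `r`. -/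
theorem perm_of_labelMask_eq {l r : List ℕ} (hr : r.Nodup) (hlen : l.length = r.length)
    (h : labelMask l = labelMask r) : l.Perm r := by
  have hsub : r ⊆ l := fun x hx => by rwa [← testBit_labelMask, h, testBit_labelMask]
  exact ((List.subperm_of_subset hr hsub).perm_of_length_le hlen.le).symm

theorem labelDigits_perm {s : ℕ} (h : isRelabelling s = true) :
    (labelDigits 10 s).Perm (List.range' 3 10) :=
  perm_of_labelMask_eq List.nodup_range' (by simp [length_labelDigits])
    ((beq_iff_eq.1 h).trans (by decide))

theorem map_relabel_perm {s : ℕ} (h : isRelabelling s = true) :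
    ((List.range' 3 10).map (relabel s)).Perm (List.range' 3 10) :=
  labelDigits_eq_map_relabel 10 s ▸ labelDigits_perm h

omit [DecidableEq α] in
theorem Set.InjOn.comp_relabel {s : ℕ} (h : isRelabelling s = true) {π : ℕ → α}
    (hπ : Set.InjOn π (Set.Iio 13)) : Set.InjOn (π ∘ relabel s) (Set.Iio 13) := by
  have hp : ((List.range 13).map (relabel s)).Perm (List.range 13) := by
    have hr : List.range 13 = [0, 1, 2] ++ List.range' 3 10 := by decide
    rw [hr, List.map_append]
    exact (map_relabel_perm h).append_left _
  refine hπ.comp (fun x hx y hy hxy => ?_) fun x hx => ?_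
  · exact List.inj_on_of_nodup_map (hp.nodup_iff.2 List.nodup_range)
      (List.mem_range.2 hx) (List.mem_range.2 hy) hxy
  · exact List.mem_range.1 (hp.subset (List.mem_map_of_mem (List.mem_range.2 hx)))

theorem toFinset_map_eq_of_labelMask_eq {l r : List ℕ} (h : labelMask l = labelMask r)
    (π : ℕ → α) : (l.map π).toFinset = (r.map π).toFinset := by
  have hmem : ∀ x, x ∈ l ↔ x ∈ r := fun x => by
    rw [← testBit_labelMask, h, testBit_labelMask]
  ext z
  simp [hmem]

theorem notMem_blocks_of_clashes (hB : IsPartialSTS blocks) {Y : List (List ℕ)} {t : List ℕ}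
    {π : ℕ → α} (hπ : Set.InjOn π (Set.Iio 13)) (hlt : ∀ x ∈ t, x < 13)
    (hYlt : ∀ b ∈ Y, ∀ x ∈ b, x < 13) (hY : ∀ b ∈ Y, (b.map π).toFinset ∈ blocks)
    (hnd : t.Nodup) (hlen : t.length = 3) (h : clashes Y t = true) :
    (t.map π).toFinset ∉ blocks := by
  intro ht
  obtain ⟨b, hb, hbt⟩ := List.any_eq_true.1 h
  rw [beq_iff_eq] at hbt
  have hfilter : t.filter (fun x => (labelMask b).testBit x) = t.filter (fun x => x ∈ b) :=
    List.filter_congr fun x _ => by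
      rw [Bool.eq_iff_iff, testBit_labelMask, decide_eq_true_eq]
  rw [hfilter] at hbt
  obtain ⟨p, q, hpq⟩ := List.length_eq_two.1 hbt
  have hp : p ∈ t ∧ p ∈ b := by
    have : p ∈ t.filter (fun x => x ∈ b) := by simp [hpq]
    simpa using this
  have hq : q ∈ t ∧ q ∈ b := by
    have : q ∈ t.filter (fun x => x ∈ b) := by simp [hpq]
    simpa using this
  have hne : p ≠ q := by
    have := hnd.filter (fun x => decide (x ∈ b))
    rw [hpq] at this
    simpa using this
  obtain ⟨r, hrt, hrb⟩ : ∃ r ∈ t, r ∉ b := by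
    by_contra hall
    push Not at hall
    rw [List.filter_eq_self.2 fun x hx => decide_eq_true (hall x hx)] at hbt
    omega
  have mem : ∀ {u : List ℕ} {x : ℕ}, x ∈ u → π x ∈ (u.map π).toFinset := fun hx =>
    List.mem_toFinset.2 (List.mem_map_of_mem hx)
  have heq := hB.eq_of_pair _ ht _ (hY b hb) (π p) (π q)
    (fun he => hne (hπ (hlt p hp.1) (hlt q hq.1) he)) (mem hp.1) (mem hq.1) (mem hp.2) (mem hq.2)
  have hr : π r ∈ (b.map π).toFinset := heq ▸ mem hrt
  obtain ⟨r', hr', hrr⟩ := List.mem_map.1 (List.mem_toFinset.1 hr)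
  exact hrb (hπ (hYlt b hb r' hr') (hlt r hrt) hrr ▸ hr')

theorem Completable.of_embeds {R : List α} {Y Z : List (List ℕ)} {t : List ℕ} {s : ℕ} {π : ℕ → α}
    (hZ : Sufficient blocks R Z) (hπ : Set.InjOn π (Set.Iio 13))
    (hR : BlockFree blocks (π 2 :: π 1 :: π 0 :: R))
    (hY : ∀ b ∈ Y, (b.map π).toFinset ∈ blocks) (ht : (t.map π).toFinset ∈ blocks)
    (h : embeds (labelMask t :: Y.map labelMask) s Z = true) : Completable blocks R π := by
  rw [embeds, Bool.and_eq_true] at h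
  obtain ⟨hs, hall⟩ := h
  obtain ⟨l, hl, hgood⟩ := hZ (π ∘ relabel s) (hπ.comp_relabel hs)
    (by simpa [relabel] using hR) (by
      intro b hb
      obtain ⟨m, hm, hmb⟩ := List.any_eq_true.1 (List.all_eq_true.1 hall b hb)
      have hmb := Nat.eq_of_beq_eq_true hmb
      rw [← List.map_map]
      rcases List.mem_cons.1 hm with rfl | hm
      · rwa [← toFinset_map_eq_of_labelMask_eq hmb]
      · obtain ⟨c, hc, rfl⟩ := List.mem_map.1 hm
        rw [← toFinset_map_eq_of_labelMask_eq hmb]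
        exact hY c hc)
  refine ⟨l, hl.trans ?_, by simpa [relabel] using hgood⟩
  rw [← List.map_map]
  exact (map_relabel_perm hs).map π

theorem mem_of_mem_closeTriples : ∀ {l : List ℕ} {t : List ℕ}, t ∈ closeTriples l → l.Nodup →
    t.Nodup ∧ t.length = 3 ∧ t ⊆ l
  | y :: c :: b :: a :: l, t, ht, hnd => by
    rw [closeTriples] at ht
    simp only [List.mem_cons] at ht
    have hnd' := (List.nodup_cons.1 hnd).2
    rcases ht with rfl | rfl | rfl | ht
    · simp_all; grind
    · simp_all; grind
    · simp_all; grind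
    · obtain ⟨h1, h2, h3⟩ := mem_of_mem_closeTriples ht hnd'
      exact ⟨h1, h2, fun x hx => List.mem_cons_of_mem _ (h3 hx)⟩
  | [], t, ht, _ | [_], t, ht, _ | [_, _], t, ht, _ | [_, _, _], t, ht, _ => by
    simp [closeTriples] at ht

theorem closeTriples_suffix (y : ℕ) (l : List ℕ) : closeTriples l ⊆ closeTriples (y :: l) := by
  rcases l with _ | ⟨c, _ | ⟨b, _ | ⟨a, l⟩⟩⟩
  · simp [closeTriples]
  · simp [closeTriples]
  · simp [closeTriples]
  · intro t ht
    rw [closeTriples]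
    simp [ht]

theorem BlockFree.append_of_closeTriples (hB : IsPartialSTS blocks) {π : ℕ → α} {R : List α}
    (hR : BlockFree blocks (π 2 :: π 1 :: π 0 :: R)) (q : List ℕ)
    (h : ∀ t ∈ closeTriples (q ++ [2, 1, 0]), (t.map π).toFinset ∉ blocks) :
    BlockFree blocks (q.map π ++ π 2 :: π 1 :: π 0 :: R) := by
  induction q with
  | nil => exact hR
  | cons y q ih =>
    refine (ih fun t ht => h t (closeTriples_suffix y _ ht)).cons hB ?_
    obtain ⟨c, b, a, l, hl, hl'⟩ : ∃ c b a l, q ++ [2, 1, 0] = c :: b :: a :: l ∧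
        (q.map π ++ π 2 :: π 1 :: π 0 :: R).take 3 = [π c, π b, π a] := by
      rcases q with _ | ⟨c, _ | ⟨b, _ | ⟨a, l⟩⟩⟩ <;> simp
    rw [List.cons_append, hl, closeTriples] at h
    rw [hl']
    have hab := h [a, b, y] (by simp)
    have hac := h [a, c, y] (by simp)
    have hbc := h [b, c, y] (by simp)
    simp only [List.map_cons, List.map_nil, List.toFinset_cons, List.toFinset_nil] at hab hac hbc
    have hdiag : ∀ p z : α, ({p, p, z} : Finset α) ∉ blocks := fun p z hp => by
      have := hB.card_eq _ hp
      have := Finset.card_le_two (a := p) (b := z)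
      simp_all
    simp only [List.mem_cons, List.not_mem_nil, or_false]
    have hswap : ∀ {p r z : α}, ({p, r, z} : Finset α) ∉ blocks → ({r, p, z} : Finset α) ∉ blocks :=
      fun h => by rwa [Finset.insert_comm]
    rintro p (hp | hp | hp) r (hr | hr | hr) <;> rw [hp, hr]
    exacts [hdiag _ _, hswap hbc, hswap hac, hbc, hdiag _ _, hswap hab, hac, hab, hdiag _ _]

theorem of_excludes {earlier : List (List (List ℕ))} {Y : List (List ℕ)} {M : List ℕ} :
    ∀ {ts : List (List ℕ)} {refs : List (ℕ × ℕ)}, excludes earlier Y M ts refs = true →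
      ∀ t ∈ ts, clashes Y t = true ∨ ∃ Z ∈ earlier, ∃ s, embeds (labelMask t :: M) s Z = true
  | t :: ts, refs, h, u, hu => by
    rw [excludes.eq_def] at h
    dsimp only at h
    by_cases hc : clashes Y t = true
    · rw [if_pos hc] at h
      rcases List.mem_cons.1 hu with rfl | hu
      · exact Or.inl hc
      · exact of_excludes h u hu
    · rw [if_neg hc] at h
      rcases refs with _ | ⟨⟨k, s⟩, refs⟩
      · simp at h
      · simp only [Bool.and_eq_true] at h
        obtain ⟨h, hrest⟩ := h
        rcases List.mem_cons.1 hu with rfl | hu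
        · rcases hk : earlier[k]? with _ | Z
          · simp [hk] at h
          · rw [hk] at h
            exact Or.inr ⟨Z, List.mem_of_getElem? hk, s, h⟩
        · exact of_excludes hrest u hu
  | [], _, _, _, hu => absurd hu List.not_mem_nil

theorem sufficient_of_excludes (hB : IsPartialSTS blocks) {R : List α}
    {earlier : List (List (List ℕ))} (hE : ∀ Z ∈ earlier, Sufficient blocks R Z)
    {Y : List (List ℕ)} {q : List ℕ} {refs : List (ℕ × ℕ)}
    (hY : ∀ b ∈ Y, ∀ x ∈ b, x < 13) (hq : q.Perm (List.range' 3 10))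
    (h : excludes earlier Y (Y.map labelMask) (closeTriples (q ++ [2, 1, 0])) refs = true) :
    Sufficient blocks R Y := by
  intro π hπ hR hblocks
  by_contra hcon
  refine hcon ⟨q.map π, hq.map π, hR.append_of_closeTriples hB q fun t ht htb => ?_⟩
  have hperm : (q ++ [2, 1, 0]).Perm (List.range 13) :=
    (hq.append_right _).trans (by decide)
  obtain ⟨hnd, hlen, hsub⟩ := mem_of_mem_closeTriples ht (hperm.nodup_iff.2 List.nodup_range)
  have hlt : ∀ x ∈ t, x < 13 := fun x hx => List.mem_range.1 (hperm.subset (hsub hx))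
  rcases of_excludes h t ht with hc | ⟨Z, hZ, s, hs⟩
  · exact notMem_blocks_of_clashes hB hπ hlt hY hblocks hnd hlen hc htb
  · exact hcon (Completable.of_embeds (hE Z hZ) hπ hR hblocks htb hs)

theorem sufficient_nil_of_certify (hB : IsPartialSTS blocks) {R : List α} :
    ∀ {cert : List (List ℕ × ℕ × List (ℕ × ℕ))} {earlier : List (List (List ℕ))},
      (∀ Z ∈ earlier, Sufficient blocks R Z) → certify earlier cert = true →
        Sufficient blocks R []
  | [], earlier, hE, h => by
    rw [certify, beq_iff_eq] at h
    exact hE [] (List.mem_of_mem_head? h)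
  | (Y, q, refs) :: rest, earlier, hE, h => by
    rw [certify] at h
    simp only [Bool.and_eq_true] at h
    obtain ⟨⟨⟨hlt, hq⟩, hex⟩, hrest⟩ := h
    refine sufficient_nil_of_certify hB (fun Z hZ => ?_) hrest
    rcases List.mem_cons.1 hZ with rfl | hZ
    · refine sufficient_of_excludes hB hE (fun b hb x hx => ?_) ?_ hex
      · exact lt_of_mem_of_labelMask_le
          (Nat.le_of_ble_eq_true (List.all_eq_true.1 hlt _ (List.mem_map_of_mem hb))) hx
      · exact labelDigits_perm hq
    · exact hE Z hZ

theorem certify_certificate : certify [] certificate = true := by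
  decide +kernel

end Sequencing

theorem stmt8 {α : Type*} [DecidableEq α] (points : Finset α) (blocks : Finset (Finset α))
    (hS : IsSTS points blocks) (hv : 13 ≤ points.card) :
    ∃ L : List α, IsGoodSeq points blocks 4 L := by
  have hB := hS.isPartialSTS
  obtain ⟨L, hnd, hsub, hlen, hL⟩ :=
    exists_blockFree_of_length hB points (points.card - 10) (by omega)
  obtain ⟨x₂, x₁, x₀, R, rfl⟩ : ∃ x₂ x₁ x₀ R, L = x₂ :: x₁ :: x₀ :: R := by
    match L, hlen with
    | x₂ :: x₁ :: x₀ :: R, _ => exact ⟨x₂, x₁, x₀, R, rfl⟩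
    | [], hlen | [_], hlen | [_, _], hlen => simp at hlen; omega
  set L := x₂ :: x₁ :: x₀ :: R with hLdef
  have hWcard : (points \ L.toFinset).toList.length = 10 := by
    rw [Finset.length_toList, Finset.card_sdiff_of_subset hsub, List.toFinset_card_of_nodup hnd]
    omega
  set W := (points \ L.toFinset).toList with hW
  have hWnd : W.Nodup := Finset.nodup_toList _
  have hdisj : ∀ x ∈ W, x ∉ L := fun x hx => by
    rw [hW, Finset.mem_toList, Finset.mem_sdiff, List.mem_toFinset] at hx
    exact hx.2
  let π : ℕ → α := fun i => (x₀ :: x₁ :: x₂ :: W).getD i x₀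
  have hlen13 : (x₀ :: x₁ :: x₂ :: W).length = 13 := by simp [hWcard]
  have hnd13 : (x₀ :: x₁ :: x₂ :: W).Nodup := by
    have hd : ∀ x ∈ W, x ≠ x₀ ∧ x ≠ x₁ ∧ x ≠ x₂ := fun x hx => by
      have := hdisj x hx
      simp only [hLdef, List.mem_cons, not_or] at this
      tauto
    simp only [hLdef, List.nodup_cons, List.mem_cons, not_or] at hnd ⊢
    refine ⟨⟨?_, ?_, fun h => (hd _ h).1 rfl⟩, ⟨?_, fun h => (hd _ h).2.1 rfl⟩,
      fun h => (hd _ h).2.2 rfl, hWnd⟩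
    · exact Ne.symm hnd.2.1.1
    · exact Ne.symm hnd.1.2.1
    · exact Ne.symm hnd.1.1
  have hπ : Set.InjOn π (Set.Iio 13) := by
    intro i hi j hj hij
    rw [Set.mem_Iio, ← hlen13] at hi hj
    simp only [π, List.getD_eq_getElem _ _ hi, List.getD_eq_getElem _ _ hj] at hij
    exact (hnd13.getElem_inj_iff).1 hij
  have hmap : (List.range' 3 10).map π = W := by
    refine List.ext_getElem (by simp [hWcard]) fun i h1 h2 => ?_
    simp only [List.getElem_map, List.getElem_range', π]
    rw [show 3 + 1 * i = i + 1 + 1 + 1 by omega]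
    simp [h2]
  obtain ⟨l, hl, hgood⟩ := sufficient_nil_of_certify hB (R := R) (by simp)
    certify_certificate π hπ hL (by simp)
  rw [hmap] at hl
  change BlockFree blocks (l ++ L) at hgood
  refine ⟨l ++ L, ?_, ?_, hgood⟩
  · exact (hl.nodup_iff.2 hWnd).append hnd fun x hx hxL => hdisj x (hl.subset hx) hxL
  · rw [List.toFinset_append, List.toFinset_eq_of_perm _ _ hl, hW, Finset.toList_toFinset,
      Finset.sdiff_union_of_subset hsub]
end
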